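/- arXiv:1308.4624 — 5 statements merged into one kernel-verified Lean document; each statement's English description precedes it below -/
import Mathlib

section
/- Suppose the field F has characteristic 2 and every element of F is a square. Then every symmetric n×n matrix X over F is B-congruent to a unique specialized pseudo-permutation (0,1)-matrix; that is, there is exactly one specialized pseudo-permutation matrix Y with all entries 0 or 1 such that Y = h'Xh for some h ∈ B. -/
open Matrix

variable {F : Type*} [Field F] {n : ℕ}

/-- Membership in `B`: invertible upper triangular matrices. -/
def InB (h : Matrix (Fin n) (Fin n) F) : Prop :=
  IsUnit h.det ∧ ∀ i j : Fin n, j < i → h i j = 0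

/-- A (0,1)-matrix: every entry is 0 or 1. -/
def ZeroOne (Y : Matrix (Fin n) (Fin n) F) : Prop :=
  ∀ i j, Y i j = 0 ∨ Y i j = 1

/-- A pseudo-permutation: a symmetric matrix such that every column has at most two
nonzero entries, and if column `j` has two nonzero entries then they are `X j j`
and `X i j` for some `i < j`. -/
def IsPseudoPerm (X : Matrix (Fin n) (Fin n) F) : Prop :=
  X.IsSymm ∧
  (∀ j i k : Fin n, i ≠ j → k ≠ j → X i j ≠ 0 → X k j ≠ 0 → i = k) ∧
  (∀ j i : Fin n, i ≠ j → X i j ≠ 0 → X j j ≠ 0 → i < j)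

/-- An `X`-pair: `i < j` with `X i j ≠ 0` and `X j j ≠ 0`. -/
def XPair (X : Matrix (Fin n) (Fin n) F) (i j : Fin n) : Prop :=
  i < j ∧ X i j ≠ 0 ∧ X j j ≠ 0

/-- An `X`-index: `s` with `X s s ≠ 0` the only nonzero entry in column `s`. -/
def XIndex (X : Matrix (Fin n) (Fin n) F) (s : Fin n) : Prop :=
  X s s ≠ 0 ∧ ∀ i, X i s ≠ 0 → i = s

/-- An `X`-pair `(i,j)` is problematic if some `X`-pair is inside it or some
`X`-index is interior to it. -/
def ProblematicPair (X : Matrix (Fin n) (Fin n) F) (i j : Fin n) : Prop :=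
  (∃ k l : Fin n, XPair X k l ∧ i < k ∧ l < j) ∨
  (∃ s : Fin n, XIndex X s ∧ i < s ∧ s < j)

/-- A specialized pseudo-permutation: a pseudo-permutation with no problematic
`X`-pairs. -/
def IsSpecializedPseudoPerm (X : Matrix (Fin n) (Fin n) F) : Prop :=
  IsPseudoPerm X ∧ ∀ i j : Fin n, XPair X i j → ¬ ProblematicPair X i j

/-- `X` and `Y` are congruent under the group of invertible upper triangular matrices. -/
def BCongruent (X Y : Matrix (Fin n) (Fin n) F) : Prop :=
  ∃ h : Matrix (Fin n) (Fin n) F, InB h ∧ Y = hᵀ * X * h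

lemma InB.blockTriangular {h : Matrix (Fin n) (Fin n) F} (hh : InB h) :
    h.BlockTriangular id := fun i j hij => hh.2 i j hij

lemma InB.mul {g h : Matrix (Fin n) (Fin n) F} (hg : InB g) (hh : InB h) : InB (g * h) :=
  ⟨by rw [det_mul]; exact hg.1.mul hh.1,
    fun _ _ hij => (hg.blockTriangular.mul hh.blockTriangular) hij⟩

lemma InB.inv {h : Matrix (Fin n) (Fin n) F} (hh : InB h) : InB h⁻¹ := by
  let := h.invertibleOfIsUnitDet hh.1
  exact ⟨isUnit_nonsing_inv_det h hh.1,
    fun _ _ hij => (blockTriangular_inv_of_blockTriangular hh.blockTriangular) hij⟩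

lemma inB_of_diag_ne_zero {h : Matrix (Fin n) (Fin n) F} (hd : ∀ i, h i i ≠ 0)
    (ht : ∀ i j : Fin n, j < i → h i j = 0) : InB h := by
  refine ⟨?_, ht⟩
  rw [det_of_isUpperTriangular (fun i j hij => ht i j hij), isUnit_iff_ne_zero]
  exact Finset.prod_ne_zero_iff.2 fun i _ => hd i

lemma BCongruent.refl (X : Matrix (Fin n) (Fin n) F) : BCongruent X X :=
  ⟨1, inB_of_diag_ne_zero (by simp) fun _ _ hij => one_apply_ne hij.ne', by simp⟩

lemma BCongruent.trans {X Y Z : Matrix (Fin n) (Fin n) F} (hXY : BCongruent X Y)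
    (hYZ : BCongruent Y Z) : BCongruent X Z := by
  obtain ⟨g, hg, rfl⟩ := hXY
  obtain ⟨h, hh, rfl⟩ := hYZ
  exact ⟨g * h, hg.mul hh, by simp only [transpose_mul, Matrix.mul_assoc]⟩

lemma BCongruent.symm {X Y : Matrix (Fin n) (Fin n) F} (hXY : BCongruent X Y) :
    BCongruent Y X := by
  obtain ⟨h, hh, rfl⟩ := hXY
  refine ⟨h⁻¹, hh.inv, ?_⟩
  have h1 : h⁻¹ᵀ * hᵀ = 1 := by rw [← transpose_mul, mul_nonsing_inv h hh.1, transpose_one]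
  rw [Matrix.mul_assoc, Matrix.mul_assoc _ h, mul_nonsing_inv h hh.1, Matrix.mul_one,
    ← Matrix.mul_assoc, h1, Matrix.one_mul]

lemma BCongruent.isSymm {X Y : Matrix (Fin n) (Fin n) F} (hXY : BCongruent X Y)
    (hX : X.IsSymm) : Y.IsSymm := by
  obtain ⟨h, -, rfl⟩ := hXY
  simp only [Matrix.IsSymm, transpose_mul, transpose_transpose, hX.eq, Matrix.mul_assoc]

/-- The congruence replacing each basis vector `e t` by `e t + c t • e m`. -/
def addMulPivot (X : Matrix (Fin n) (Fin n) F) (m : Fin n) (c : Fin n → F) :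
    Matrix (Fin n) (Fin n) F :=
  of fun s t => X s t + c s * X m t + c t * X s m + c s * c t * X m m

lemma addMulPivot_apply (X : Matrix (Fin n) (Fin n) F) (m : Fin n) (c : Fin n → F)
    (s t : Fin n) :
    addMulPivot X m c s t = X s t + c s * X m t + c t * X s m + c s * c t * X m m := rfl

lemma bCongruent_addMulPivot (X : Matrix (Fin n) (Fin n) F) (m : Fin n) (c : Fin n → F)
    (hc : ∀ t, c t ≠ 0 → m < t) : BCongruent X (addMulPivot X m c) := by
  have hm : c m = 0 := by
    by_contra h
    exact lt_irrefl _ (hc m h)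
  refine ⟨of fun a t => (if a = t then 1 else 0) + if a = m then c t else 0,
    inB_of_diag_ne_zero ?_ ?_, ?_⟩
  · intro i
    by_cases h : i = m
    · subst h; simp [hm]
    · simp [h]
  · intro i j hij
    have : i = m → c j = 0 := by
      rintro rfl
      by_contra h
      exact absurd (hc j h) hij.not_gt
    simpa [hij.ne'] using this
  · ext s t
    simp only [addMulPivot_apply, mul_apply, transpose_apply, of_apply, add_mul, mul_add,
      Finset.sum_add_distrib, ite_mul, mul_ite, one_mul, zero_mul, mul_one, mul_zero,
      Finset.sum_ite_eq', Finset.mem_univ, if_true]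
    ring

lemma bCongruent_scale (X : Matrix (Fin n) (Fin n) F) (d : Fin n → F) (hd : ∀ t, d t ≠ 0) :
    BCongruent X (of fun s t => d s * d t * X s t) := by
  refine ⟨diagonal d, inB_of_diag_ne_zero (by simpa using hd)
    fun _ _ hij => diagonal_apply_ne _ hij.ne', ?_⟩
  ext s t
  simp only [diagonal_transpose, mul_diagonal, diagonal_mul, of_apply]
  ring

/-- The columns of `X` indexed by `T` satisfy the conditions on a pseudo-permutation
(0,1)-matrix, and vanish outside `T`. -/
def ReducedOn (X : Matrix (Fin n) (Fin n) F) (T : Finset (Fin n)) : Prop :=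
  ∀ a ∈ T, (∀ i, X i a = 0 ∨ X i a = 1) ∧ (∀ i ∉ T, X i a = 0) ∧
    (∀ i k, i ≠ a → k ≠ a → X i a ≠ 0 → X k a ≠ 0 → i = k) ∧
    (∀ i, i ≠ a → X i a ≠ 0 → X a a ≠ 0 → i < a)

lemma ReducedOn.congr {X Y : Matrix (Fin n) (Fin n) F} {T : Finset (Fin n)}
    (hX : ReducedOn X T) (h : ∀ a ∈ T, ∀ i, Y i a = X i a) : ReducedOn Y T := by
  intro a ha
  simpa only [h a ha] using hX a ha

lemma ReducedOn.pivot {X : Matrix (Fin n) (Fin n) F} {T : Finset (Fin n)}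
    (hX : ReducedOn X T) {m : Fin n} (hm : m ∉ T) {c : Fin n → F} (hc : ∀ t ∈ T, c t = 0) :
    ReducedOn (addMulPivot X m c) T :=
  hX.congr fun a ha i => by simp [addMulPivot_apply, hc a ha, (hX a ha).2.1 m hm]

lemma ReducedOn.scale {X : Matrix (Fin n) (Fin n) F} {T : Finset (Fin n)}
    (hX : ReducedOn X T) {d : Fin n → F} (hd : ∀ t ∈ T, d t = 1) :
    ReducedOn (of fun s t => d s * d t * X s t) T :=
  hX.congr fun a ha i => by
    by_cases hi : i ∈ T
    · simp [hd a ha, hd i hi]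
    · simp [(hX a ha).2.1 i hi]

lemma ReducedOn.insert_index {X : Matrix (Fin n) (Fin n) F} {T : Finset (Fin n)}
    (hX : ReducedOn X T) {m : Fin n} (h01 : X m m = 0 ∨ X m m = 1)
    (h : ∀ i, i ≠ m → X i m = 0) : ReducedOn X (insert m T) := by
  intro a ha
  rcases Finset.mem_insert.1 ha with rfl | haT
  · refine ⟨fun i => ?_, fun i hi => h i fun e => hi (by simp [e]),
      fun i _ hi _ h0 _ => absurd (h i hi) h0, fun i hi h0 => absurd (h i hi) h0⟩
    by_cases e : i = a
    · rwa [e]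
    · exact Or.inl (h i e)
  · obtain ⟨h1, h2, h3, h4⟩ := hX a haT
    exact ⟨h1, fun i hi => h2 i fun e => hi (Finset.mem_insert_of_mem e), h3, h4⟩

lemma ReducedOn.insert_pair {X : Matrix (Fin n) (Fin n) F} {T : Finset (Fin n)}
    (hX : ReducedOn X T) {m j : Fin n} (hmj : m < j) (hmm : X m m = 0) (hjm : X j m = 1)
    (hmj1 : X m j = 1) (hjj : X j j = 0 ∨ X j j = 1)
    (hm : ∀ i, i ≠ j → X i m = 0) (hj : ∀ i, i ≠ m → i ≠ j → X i j = 0) :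
    ReducedOn X (insert m (insert j T)) := by
  intro a ha
  simp only [Finset.mem_insert] at ha
  rcases ha with rfl | rfl | haT
  · refine ⟨fun i => ?_, fun i hi => hm i fun e => hi (by simp [e]), ?_, ?_⟩
    · by_cases e : i = j
      · exact Or.inr (e ▸ hjm)
      · exact Or.inl (hm i e)
    · intro i k _ _ h1 h2
      have e1 : i = j := by by_contra e; exact h1 (hm i e)
      have e2 : k = j := by by_contra e; exact h2 (hm k e)
      rw [e1, e2]
    · intro i _ _ h
      exact absurd hmm h
  · have key : ∀ i, i ≠ a → X i a ≠ 0 → i = m := fun i h1 h2 => by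
      by_contra e
      exact h2 (hj i e h1)
    refine ⟨fun i => ?_, fun i hi => hj i (fun e => hi (by simp [e])) fun e => hi (by simp [e]),
      ?_, ?_⟩
    · by_cases e : i = a
      · rwa [e]
      by_cases e' : i = m
      · exact Or.inr (e' ▸ hmj1)
      · exact Or.inl (hj i e' e)
    · intro i k h1 h2 h3 h4
      rw [key i h1 h3, key k h2 h4]
    · intro i h1 h2 _
      rwa [key i h1 h2]
  · obtain ⟨h1, h2, h3, h4⟩ := hX a haT
    exact ⟨h1, fun i hi => h2 i fun e => hi (by simp [e]), h3, h4⟩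

lemma ReducedOn.exists_scale_diag_eq_one (hsq : ∀ a : F, ∃ b : F, b ^ 2 = a)
    {X : Matrix (Fin n) (Fin n) F} {T : Finset (Fin n)}
    (hX : ReducedOn X T) {m : Fin n} (hm : m ∉ T) (hmm : X m m ≠ 0) :
    ∃ Y, BCongruent X Y ∧ ReducedOn Y T ∧ Y m m = 1 := by
  obtain ⟨r, hr⟩ := hsq (X m m)
  have hr0 : r ≠ 0 := by
    rintro rfl
    exact hmm (by simpa using hr.symm)
  refine ⟨_, bCongruent_scale X (Function.update 1 m r⁻¹) fun t => ?_, hX.scale fun t ht => ?_, ?_⟩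
  · by_cases h : t = m
    · subst h; simpa using hr0
    · simp [h]
  · rw [Function.update_of_ne (by rintro rfl; exact hm ht)]; rfl
  · simp only [of_apply, Function.update_self, ← hr]
    field_simp

lemma ReducedOn.exists_scale_pair (hsq : ∀ a : F, ∃ b : F, b ^ 2 = a)
    {X : Matrix (Fin n) (Fin n) F} {T : Finset (Fin n)}
    (hX : ReducedOn X T) {m j : Fin n} (hm : m ∉ T) (hj : j ∉ T) (hmj : m ≠ j)
    (hmm : X m m = 0) (h : X m j ≠ 0) :
    ∃ Y, BCongruent X Y ∧ ReducedOn Y T ∧ Y m m = 0 ∧ Y m j = 1 ∧ (Y j j = 0 ∨ Y j j = 1) ∧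
      ∀ t, X m t = 0 → Y m t = 0 := by
  obtain ⟨r, hr0, hr⟩ : ∃ r : F, r ≠ 0 ∧ (r⁻¹ * r⁻¹ * X j j = 0 ∨ r⁻¹ * r⁻¹ * X j j = 1) := by
    by_cases h0 : X j j = 0
    · exact ⟨1, one_ne_zero, Or.inl (by simp [h0])⟩
    · obtain ⟨r, hr⟩ := hsq (X j j)
      have hr0 : r ≠ 0 := by
        rintro rfl
        exact h0 (by simpa using hr.symm)
      refine ⟨r, hr0, Or.inr ?_⟩
      rw [← hr]
      field_simp
  have hdj : Function.update (Function.update (1 : Fin n → F) j r⁻¹) m (r / X m j) j = r⁻¹ := by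
    rw [Function.update_of_ne hmj.symm, Function.update_self]
  refine ⟨_, bCongruent_scale X
    (Function.update (Function.update 1 j r⁻¹) m (r / X m j)) fun t => ?_,
    hX.scale fun t ht => ?_, ?_, ?_, ?_, fun t ht => ?_⟩
  · by_cases h1 : t = m
    · subst h1; simpa using ⟨hr0, h⟩
    · by_cases h2 : t = j
      · subst h2; simpa [h1] using hr0
      · simp [h1, h2]
  · rw [Function.update_of_ne (by rintro rfl; exact hm ht),
      Function.update_of_ne (by rintro rfl; exact hj ht)]
    rfl
  · simp [hmm]
  · simp only [of_apply, hdj, Function.update_self]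
    field_simp
  · simpa only [of_apply, hdj] using hr
  · simp [ht]

lemma ReducedOn.exists_insert (hsq : ∀ a : F, ∃ b : F, b ^ 2 = a)
    {X : Matrix (Fin n) (Fin n) F} (hXs : X.IsSymm) {T : Finset (Fin n)}
    (hX : ReducedOn X T) (hT : T ≠ Finset.univ) :
    ∃ (Y : Matrix (Fin n) (Fin n) F) (S : Finset (Fin n)),
      BCongruent X Y ∧ T ⊂ S ∧ ReducedOn Y S := by
  obtain ⟨m, hmT, hmin⟩ : ∃ m, m ∉ T ∧ ∀ t, t ∉ T → m ≤ t := by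
    have hne : Tᶜ.Nonempty := by
      rwa [Finset.nonempty_iff_ne_empty, Ne, Finset.compl_eq_empty_iff]
    exact ⟨Tᶜ.min' hne, by simpa using Tᶜ.min'_mem hne, fun t ht => Tᶜ.min'_le t (by simpa)⟩
  have hlt : ∀ t, t ∉ T → t ≠ m → m < t := fun t h1 h2 => lt_of_le_of_ne (hmin t h1) h2.symm
  by_cases hmm : X m m = 0
  · by_cases hrow : ∃ j, X m j ≠ 0
    · obtain ⟨j, hj, hjmin⟩ : ∃ j, X m j ≠ 0 ∧ ∀ t, X m t ≠ 0 → j ≤ t := by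
        classical
        have hne : (Finset.univ.filter fun j => X m j ≠ 0).Nonempty := by
          obtain ⟨j, hj⟩ := hrow
          exact ⟨j, by simpa using hj⟩
        exact ⟨_, by simpa using Finset.min'_mem _ hne,
          fun t ht =>
            Finset.min'_le _ t (Finset.mem_filter.2 ⟨Finset.mem_univ t, ht⟩)⟩
      have hjm : j ≠ m := by rintro rfl; exact hj hmm
      have hjT : j ∉ T := fun h => hj ((hX j h).2.1 m hmT)
      have hmj : m < j := hlt j hjT hjm
      obtain ⟨Y, hXY, hY, hYmm, hYmj, hYjj, hYm⟩ :=
        hX.exists_scale_pair hsq hmT hjT hjm.symm hmm hj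
      have hYs := hXY.isSymm hXs
      have hY0 : ∀ t, t < j → Y m t = 0 := fun t ht => hYm t <| by
        by_contra h
        exact absurd (hjmin t h) ht.not_ge
      set c : Fin n → F := fun t => if j < t then - Y m t else 0 with hc
      have hcT : ∀ t ∈ T, c t = 0 := fun t ht => by simp [hc, (hY t ht).2.1 m hmT]
      have hcm : c m = 0 := by simp [hc, hmj.not_gt]
      have hcj : c j = 0 := by simp [hc]
      have hYZ := bCongruent_addMulPivot Y j c fun t ht => by
        by_contra h
        exact ht (by simp [hc, h])
      have hZ := hY.pivot hjT hcT
      have hZs := hYZ.isSymm hYs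
      set Z := addMulPivot Y j c with hZdef
      have hZmm : Z m m = 0 := by simp [hZdef, addMulPivot_apply, hcm, hYmm]
      have hZmj : Z m j = 1 := by simp [hZdef, addMulPivot_apply, hcm, hcj, hYmj]
      have hZjj : Z j j = 0 ∨ Z j j = 1 := by simpa [hZdef, addMulPivot_apply, hcj] using hYjj
      have hZm : ∀ t, t ≠ j → Z m t = 0 := by
        intro t ht
        rcases lt_or_gt_of_ne ht with h | h
        · simp [hZdef, addMulPivot_apply, hcm, show c t = 0 by simp [hc, h.not_gt], hY0 t h]
        · simp [hZdef, addMulPivot_apply, hcm, show c t = -Y m t by simp [hc, h], hYmj]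
      clear_value Z
      set d : Fin n → F := fun t => if t = j ∨ t = m then 0 else - Z j t with hd
      have hdT : ∀ t ∈ T, d t = 0 := fun t ht => by simp [hd, (hZ t ht).2.1 j hjT]
      have hdm : d m = 0 := by simp [hd]
      have hdj : d j = 0 := by simp [hd]
      have hZW := bCongruent_addMulPivot Z m d fun t ht => by
        refine hlt t (fun h => ht (hdT t h)) ?_
        rintro rfl
        exact ht hdm
      have hW := hZ.pivot hmT hdT
      have hWs := hZW.isSymm hZs
      have hWmj : addMulPivot Z m d m j = 1 := by simp [addMulPivot_apply, hdm, hdj, hZmj]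
      refine ⟨_, insert m (insert j T), (hXY.trans hYZ).trans hZW, ?_,
        hW.insert_pair hmj ?_ ?_ hWmj ?_ ?_ ?_⟩
      · refine Finset.ssubset_iff_subset_ne.2
          ⟨fun t ht => by simp [ht], fun e => hmT (e ▸ Finset.mem_insert_self _ _)⟩
      · simp [addMulPivot_apply, hdm, hZmm]
      · rw [← hWs.apply, hWmj]
      · simpa [addMulPivot_apply, hdj] using hZjj
      · intro i hi
        rw [← hWs.apply]
        simp [addMulPivot_apply, hdm, hZmm, hZm i hi]
      · intro i him hij
        rw [← hWs.apply]
        have : Z j m = 1 := by rw [← hZs.apply, hZmj]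
        simp only [addMulPivot_apply, hdj, this]
        simp [hd, him, hij]
    · push Not at hrow
      refine ⟨X, insert m T, .refl X, Finset.ssubset_insert hmT,
        hX.insert_index (Or.inl hmm) fun i _ => ?_⟩
      rw [← hXs.apply, hrow]
  · obtain ⟨Y, hXY, hY, hYmm⟩ := hX.exists_scale_diag_eq_one hsq hmT hmm
    have hYs := hXY.isSymm hXs
    set c : Fin n → F := fun t => if t = m then 0 else - Y m t with hc
    have hcT : ∀ t ∈ T, c t = 0 := fun t ht => by simp [hc, (hY t ht).2.1 m hmT]
    have hcm : c m = 0 := by simp [hc]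
    have hYZ := bCongruent_addMulPivot Y m c fun t ht => by
      refine hlt t (fun h => ht (hcT t h)) ?_
      rintro rfl
      exact ht hcm
    refine ⟨_, insert m T, hXY.trans hYZ, Finset.ssubset_insert hmT,
      (hY.pivot hmT hcT).insert_index (Or.inr ?_) fun i hi => ?_⟩
    · simp [addMulPivot_apply, hcm, hYmm]
    · rw [← (hYZ.isSymm hYs).apply]
      simp only [addMulPivot_apply, hcm, hYmm]
      simp [hc, hi]

lemma ReducedOn.exists_univ (hsq : ∀ a : F, ∃ b : F, b ^ 2 = a)
    (X : Matrix (Fin n) (Fin n) F) (hXs : X.IsSymm) (T : Finset (Fin n)) (hX : ReducedOn X T) :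
    ∃ Y, BCongruent X Y ∧ ReducedOn Y Finset.univ := by
  by_cases hT : T = Finset.univ
  · exact ⟨X, .refl X, hT ▸ hX⟩
  · obtain ⟨Y, S, hXY, hTS, hY⟩ := hX.exists_insert hsq hXs hT
    obtain ⟨Z, hYZ, hZ⟩ := hY.exists_univ hsq Y (hXY.isSymm hXs) S
    exact ⟨Z, hXY.trans hYZ, hZ⟩
termination_by Tᶜ.card
decreasing_by exact Finset.card_lt_card (Finset.compl_ssubset_compl.2 hTS)

lemma exists_isPseudoPerm_zeroOne (hsq : ∀ a : F, ∃ b : F, b ^ 2 = a)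
    (X : Matrix (Fin n) (Fin n) F) (hXs : X.IsSymm) :
    ∃ Y, BCongruent X Y ∧ IsPseudoPerm Y ∧ ZeroOne Y := by
  obtain ⟨Y, hXY, hY⟩ := ReducedOn.exists_univ hsq X hXs ∅ fun a ha => by simp at ha
  have h := fun a => hY a (Finset.mem_univ a)
  exact ⟨Y, hXY, ⟨hXY.isSymm hXs, fun j => (h j).2.2.1, fun j => (h j).2.2.2⟩,
    fun i j => (h j).1 i⟩

/-- In characteristic two, the diagonal entry of the pair `(i, j)` can be removed with the help
of a diagonal entry at an interior index `s`. -/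
lemma bCongruent_sub_single (hchar : (2 : F) = 0) {X : Matrix (Fin n) (Fin n) F}
    (hXs : X.IsSymm) {i j s : Fin n} (his : i < s) (hsj : s < j)
    (hss : X s s = 1) (hij : X i j = 1) (hi : ∀ t, t ≠ j → X i t = 0)
    (hs : ∀ t, X s t ≠ 0 → i < t) (hsj0 : X s j = 0) :
    BCongruent X (X + single j j 1) := by
  have h1 := bCongruent_addMulPivot X s (Pi.single j 1) fun t ht => by
    by_cases e : t = j
    · rwa [e]
    · simp [e] at ht
  have h2 := h1.trans (bCongruent_addMulPivot _ i (fun t => X s t) hs)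
  convert h2 using 1
  have his0 : X i s = 0 := hi s hsj.ne
  have hii : X i i = 0 := hi i (his.trans hsj).ne
  have hsi0 : X s i = 0 := by rw [← hXs.apply, his0]
  have hrow : ∀ t, X i t = if t = j then 1 else 0 := fun t => by
    split_ifs with e
    · rw [e, hij]
    · exact hi t e
  have hne : i ≠ j := (his.trans hsj).ne
  ext a b
  have ea : X a i = X i a := hXs.apply i a
  have eb : X a s = X s a := hXs.apply s a
  simp only [addMulPivot_apply, Matrix.add_apply, single_apply, Pi.single_apply, his0, hii, hsi0,
    hss, hne, if_false, ea, eb, hrow]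
  by_cases haj : a = j <;> by_cases hbj : b = j
  · subst haj hbj
    simp only [hsj0]
    simp
  · simp only [haj, hbj, Ne.symm hbj, if_true, if_false, hsj0, and_false]
    linear_combination (-X s b) * hchar
  · simp only [haj, hbj, Ne.symm haj, if_true, if_false, hsj0, false_and]
    linear_combination (-X s a) * hchar
  · simp [haj, hbj, Ne.symm haj]

lemma IsPseudoPerm.of_support_subset {X Y : Matrix (Fin n) (Fin n) F} (hX : IsPseudoPerm X)
    (hYs : Y.IsSymm) (h : ∀ s t, Y s t ≠ 0 → X s t ≠ 0) : IsPseudoPerm Y :=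
  ⟨hYs, fun j i k hi hk h1 h2 => hX.2.1 j i k hi hk (h _ _ h1) (h _ _ h2),
    fun j i hi h1 h2 => hX.2.2 j i hi (h _ _ h1) (h _ _ h2)⟩

lemma ProblematicPair.exists_interior {X : Matrix (Fin n) (Fin n) F} (hX : IsPseudoPerm X)
    {i j : Fin n} (h : ProblematicPair X i j) :
    ∃ s, i < s ∧ s < j ∧ X s s ≠ 0 ∧ ∀ t, X s t ≠ 0 → i < t ∧ t < j := by
  rcases h with ⟨k, l, ⟨hkl, h1, h2⟩, hik, hlj⟩ | ⟨s, ⟨h1, h2⟩, his, hsj⟩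
  · refine ⟨l, hik.trans hkl, hlj, h2, fun t ht => ?_⟩
    rw [← hX.1.apply] at ht
    by_cases e : t = l
    · rw [e]
      exact ⟨hik.trans hkl, hlj⟩
    · rw [hX.2.1 l t k e hkl.ne ht h1]
      exact ⟨hik, hkl.trans hlj⟩
  · refine ⟨s, his, hsj, h1, fun t ht => ?_⟩
    rw [← hX.1.apply] at ht
    rw [h2 t ht]
    exact ⟨his, hsj⟩

open Classical in
lemma exists_isSpecializedPseudoPerm (hchar : (2 : F) = 0) (X : Matrix (Fin n) (Fin n) F)
    (hX : IsPseudoPerm X) (h01 : ZeroOne X) :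
    ∃ Y, BCongruent X Y ∧ IsSpecializedPseudoPerm Y ∧ ZeroOne Y := by
  by_cases hprob : ∃ i j, XPair X i j ∧ ProblematicPair X i j
  · obtain ⟨i, j, ⟨hlt, hij, hjj⟩, hp⟩ := hprob
    obtain ⟨s, his, hsj, hss, hs⟩ := hp.exists_interior hX
    have one : ∀ {a b}, X a b ≠ 0 → X a b = 1 := fun {a b} h => (h01 a b).resolve_left h
    have hii : X i i = 0 := by
      by_contra h
      exact absurd (hX.2.2 i j hlt.ne' (by rwa [hX.1.apply]) h) hlt.not_gt
    have hcong := bCongruent_sub_single hchar hX.1 his hsj (one hss) (one hij)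
      (fun t ht => by
        by_contra h
        rw [← hX.1.apply] at h
        by_cases e : t = i
        · exact h (e ▸ hii)
        · exact ht (hX.2.1 i t j e hlt.ne' h (by rwa [hX.1.apply])))
      (fun t ht => (hs t ht).1)
      (by
        by_contra h
        exact lt_irrefl _ (hs j h).2)
    obtain ⟨Y, hY⟩ : ∃ Y, Y = X + single j j 1 := ⟨_, rfl⟩
    rw [← hY] at hcong
    have hYjj : Y j j = 0 := by
      rw [hY, Matrix.add_apply, one hjj]
      simpa [one_add_one_eq_two] using hchar
    have hYne : ∀ a b, ¬ (a = j ∧ b = j) → Y a b = X a b := fun a b h => by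
      have : ¬ (j = a ∧ j = b) := fun h' => h ⟨h'.1.symm, h'.2.symm⟩
      simp [hY, this]
    have hYX : ∀ a b, Y a b ≠ 0 → X a b ≠ 0 := fun a b h => by
      by_cases e : a = j ∧ b = j
      · rw [e.1, e.2] at h
        exact absurd hYjj h
      · rwa [hYne a b e] at h
    have hlt_card : (Finset.univ.filter fun a => Y a a ≠ 0).card <
        (Finset.univ.filter fun a => X a a ≠ 0).card := by
      refine Finset.card_lt_card (Finset.ssubset_iff_of_subset ?_ |>.2 ⟨j, ?_, ?_⟩)
      · intro a ha
        simpa using hYX a a (by simpa using ha)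
      · simpa using hjj
      · rw [Finset.mem_filter]
        exact fun h => h.2 hYjj
    obtain ⟨Z, hYZ, hZ⟩ := exists_isSpecializedPseudoPerm hchar Y
      (hX.of_support_subset (hcong.isSymm hX.1) hYX) (fun a b => by
        by_cases e : a = j ∧ b = j
        · rw [e.1, e.2]
          exact Or.inl hYjj
        · rw [hYne a b e]
          exact h01 a b)
    exact ⟨Z, hcong.trans hYZ, hZ⟩
  · push Not at hprob
    exact ⟨X, .refl X, ⟨hX, hprob⟩, h01⟩
termination_by (Finset.univ.filter fun a => X a a ≠ 0).card

/-- `v` lies in the span of the first `a` basis vectors and is `X`-orthogonal to the first `b`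
basis vectors. -/
def InKer (X : Matrix (Fin n) (Fin n) F) (a b : ℕ) (v : Fin n → F) : Prop :=
  (∀ t : Fin n, a ≤ t → v t = 0) ∧ ∀ u : Fin n, (u : ℕ) < b → (X *ᵥ v) u = 0

/-- Some vector in the kernel `InKer X (a + 1) b` has a nonzero `a`-th coordinate. -/
def HasLeading (X : Matrix (Fin n) (Fin n) F) (a : Fin n) (b : ℕ) : Prop :=
  ∃ v, InKer X (a + 1) b v ∧ v a ≠ 0

/-- Some vector in the kernel `InKer X a b` is not isotropic. -/
def HasAnisotropic (X : Matrix (Fin n) (Fin n) F) (a b : ℕ) : Prop :=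
  ∃ v, InKer X a b v ∧ v ⬝ᵥ (X *ᵥ v) ≠ 0

lemma InB.mulVec_eq_zero {h : Matrix (Fin n) (Fin n) F} (hh : InB h) {a : ℕ} {v : Fin n → F}
    (hv : ∀ t : Fin n, a ≤ t → v t = 0) (t : Fin n) (ht : a ≤ t) : (h *ᵥ v) t = 0 := by
  rw [mulVec, dotProduct]
  refine Finset.sum_eq_zero fun s _ => ?_
  rcases lt_or_ge s t with hst | hts
  · rw [hh.2 t s hst, zero_mul]
  · rw [hv s (ht.trans hts), mul_zero]

lemma InB.transpose_mulVec_eq_zero {h : Matrix (Fin n) (Fin n) F} (hh : InB h) {b : ℕ}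
    {v : Fin n → F} (hv : ∀ t : Fin n, (t : ℕ) < b → v t = 0) (t : Fin n) (ht : (t : ℕ) < b) :
    (hᵀ *ᵥ v) t = 0 := by
  rw [mulVec, dotProduct]
  refine Finset.sum_eq_zero fun s _ => ?_
  rcases lt_or_ge t s with hst | hts
  · rw [transpose_apply, hh.2 s t hst, zero_mul]
  · rw [hv s (lt_of_le_of_lt hts ht), mul_zero]

lemma InKer.mulVec {X h : Matrix (Fin n) (Fin n) F} (hh : InB h) {a b : ℕ} {v : Fin n → F}
    (hv : InKer (hᵀ * X * h) a b v) : InKer X a b (h *ᵥ v) := by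
  refine ⟨hh.mulVec_eq_zero hv.1, fun u hu => ?_⟩
  have key : X *ᵥ (h *ᵥ v) = h⁻¹ᵀ *ᵥ ((hᵀ * X * h) *ᵥ v) := by
    have h1 : h⁻¹ᵀ * hᵀ = 1 := by rw [← transpose_mul, mul_nonsing_inv h hh.1, transpose_one]
    rw [mulVec_mulVec, mulVec_mulVec, ← Matrix.mul_assoc, ← Matrix.mul_assoc, h1, Matrix.one_mul]
  rw [key]
  exact hh.inv.transpose_mulVec_eq_zero hv.2 u hu

lemma BCongruent.hasLeading {X Y : Matrix (Fin n) (Fin n) F} (hXY : BCongruent X Y) {a : Fin n}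
    {b : ℕ} (hY : HasLeading Y a b) : HasLeading X a b := by
  obtain ⟨h, hh, rfl⟩ := hXY
  obtain ⟨v, hv, hva⟩ := hY
  have hw := hv.mulVec hh
  refine ⟨h *ᵥ v, hw, fun h0 => hva ?_⟩
  have hv' : v = h⁻¹ *ᵥ (h *ᵥ v) := by
    rw [mulVec_mulVec, nonsing_inv_mul h hh.1, one_mulVec]
  rw [hv']
  refine hh.inv.mulVec_eq_zero (a := a) (fun t ht => ?_) a le_rfl
  rcases eq_or_lt_of_le ht with e | hlt
  · rw [← Fin.ext e, h0]
  · exact hw.1 t hlt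

lemma BCongruent.hasAnisotropic {X Y : Matrix (Fin n) (Fin n) F} (hXY : BCongruent X Y)
    {a b : ℕ} (hY : HasAnisotropic Y a b) : HasAnisotropic X a b := by
  obtain ⟨h, hh, rfl⟩ := hXY
  obtain ⟨v, hv, hq⟩ := hY
  refine ⟨h *ᵥ v, hv.mulVec hh, ?_⟩
  convert hq using 1
  rw [Matrix.mul_assoc, ← mulVec_mulVec, ← mulVec_mulVec v X h, dotProduct_mulVec v hᵀ,
    vecMul_transpose]

/-- In characteristic two, the quadratic form of a symmetric matrix is diagonal. -/
lemma dotProduct_mulVec_self_eq_sum_diag (hchar : (2 : F) = 0) {X : Matrix (Fin n) (Fin n) F}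
    (hX : X.IsSymm) (v : Fin n → F) : v ⬝ᵥ (X *ᵥ v) = ∑ s, X s s * v s ^ 2 := by
  classical
  have h1 : v ⬝ᵥ (X *ᵥ v) = ∑ p : Fin n × Fin n, v p.1 * (X p.1 p.2 * v p.2) := by
    simp only [dotProduct, mulVec, Finset.mul_sum, Fintype.sum_prod_type]
  have h2 : ∑ s, X s s * v s ^ 2 =
      ∑ p : Fin n × Fin n, if p.1 = p.2 then v p.1 * (X p.1 p.2 * v p.2) else 0 := by
    simp only [Fintype.sum_prod_type, Finset.sum_ite_eq, Finset.mem_univ, if_true]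
    exact Finset.sum_congr rfl fun s _ => by ring
  rw [h1, h2, ← sub_eq_zero, ← Finset.sum_sub_distrib]
  refine Finset.sum_involution (fun p _ => p.swap) ?_ ?_ (fun _ _ => Finset.mem_univ _)
    fun p _ => p.swap_swap
  · rintro ⟨s, t⟩ -
    by_cases e : s = t
    · simp [e]
    · simp only [Prod.swap, e, Ne.symm e, if_false, hX.apply s t]
      linear_combination (v s * X s t * v t) * hchar
  · rintro ⟨s, t⟩ - h e
    apply h
    simp only [Prod.swap, Prod.mk.injEq] at e
    simp [e.2]

/-- `(i, a)` is a position of the partial involution underlying `X`. -/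
def Linked (X : Matrix (Fin n) (Fin n) F) (i a : Fin n) : Prop :=
  X i a ≠ 0 ∧ (i = a → XIndex X a)

lemma mulVec_eq_of_row {X : Matrix (Fin n) (Fin n) F} {v : Fin n → F} {i a : Fin n}
    (h : ∀ t, t ≠ a → X i t = 0 ∨ v t = 0) : (X *ᵥ v) i = X i a * v a :=
  Finset.sum_eq_single a (fun t _ ht => by rcases h t ht with h | h <;> simp [h])
    fun h => absurd (Finset.mem_univ a) h

lemma IsPseudoPerm.hasLeading_iff {X : Matrix (Fin n) (Fin n) F} (hX : IsPseudoPerm X)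
    {i a : Fin n} (hi : Linked X i a) (b : ℕ) : HasLeading X a b ↔ b ≤ i := by
  constructor
  · rintro ⟨v, hv, hva⟩
    by_contra! hb
    have h0 := hv.2 i hb
    rw [mulVec_eq_of_row (a := a)] at h0
    · exact (mul_ne_zero hi.1 hva) h0
    · intro t ht
      by_cases hit : X i t = 0
      · exact Or.inl hit
      refine Or.inr (hv.1 t ?_)
      rw [← hX.1.apply] at hit
      by_cases hia : i = a
      · subst hia
        exact absurd ((hi.2 rfl).2 t hit) ht
      by_cases hti : t = i
      · subst hti
        exact hX.2.2 t a (Ne.symm hia) (by rw [hX.1.apply]; exact hi.1) hit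
      · exact absurd (hX.2.1 i t a hti (Ne.symm hia) hit (by rw [hX.1.apply]; exact hi.1)) ht
  · intro hb
    refine ⟨Pi.single a 1, ⟨fun t ht => ?_, fun u hu => ?_⟩, by simp⟩
    · rw [Pi.single_eq_of_ne]
      rintro rfl
      omega
    · rw [mulVec_single_one, col_apply]
      by_contra h0
      have hui : u < i := Nat.lt_of_lt_of_le hu hb
      by_cases hia : i = a
      · subst hia
        exact hui.ne ((hi.2 rfl).2 u h0)
      by_cases hua : u = a
      · subst hua
        exact absurd (hX.2.2 u i hia hi.1 h0) hui.not_gt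
      · exact hui.ne (hX.2.1 a u i hua hia h0 hi.1)

lemma hasLeading_of_col_eq_zero {X : Matrix (Fin n) (Fin n) F} {a : Fin n}
    (h : ∀ i, X i a = 0) (b : ℕ) : HasLeading X a b := by
  refine ⟨Pi.single a 1, ⟨fun t ht => ?_, fun u _ => ?_⟩, by simp⟩
  · rw [Pi.single_eq_of_ne]
    rintro rfl
    omega
  · rw [mulVec_single_one, col_apply, h]

lemma exists_linked {X : Matrix (Fin n) (Fin n) F} {a : Fin n} (h : ∃ i, X i a ≠ 0) :
    ∃ i, Linked X i a := by
  obtain ⟨i, hi⟩ := h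
  by_cases hk : ∃ k, k ≠ a ∧ X k a ≠ 0
  · obtain ⟨k, hka, hk⟩ := hk
    exact ⟨k, hk, fun e => absurd e hka⟩
  · push Not at hk
    have key : ∀ k, X k a ≠ 0 → k = a := fun k h => by
      by_contra e
      exact h (hk k e)
    obtain rfl := key i hi
    exact ⟨i, hi, fun _ => ⟨hi, key⟩⟩

lemma BCongruent.linked {X Y : Matrix (Fin n) (Fin n) F} (hXY : BCongruent X Y)
    (hX : IsPseudoPerm X) (hY : IsPseudoPerm Y) {i a : Fin n} (hi : Linked X i a) :
    Linked Y i a := by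
  have hiff : ∀ b, HasLeading Y a b ↔ b ≤ i := fun b =>
    ⟨fun h => (hX.hasLeading_iff hi b).1 (hXY.hasLeading h),
      fun h => hXY.symm.hasLeading ((hX.hasLeading_iff hi b).2 h)⟩
  by_cases hcol : ∃ k, Y k a ≠ 0
  · obtain ⟨k, hk⟩ := exists_linked hcol
    have h1 : (k : ℕ) ≤ i := (hiff k).1 ((hY.hasLeading_iff hk k).2 le_rfl)
    have h2 : (i : ℕ) ≤ k := (hY.hasLeading_iff hk i).1 ((hiff i).2 le_rfl)
    rwa [Fin.ext (le_antisymm h2 h1)]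
  · push Not at hcol
    have := (hiff (i + 1)).1 (hasLeading_of_col_eq_zero hcol _)
    omega

lemma IsSpecializedPseudoPerm.not_hasAnisotropic (hchar : (2 : F) = 0)
    {X : Matrix (Fin n) (Fin n) F} (hX : IsSpecializedPseudoPerm X) {i j : Fin n}
    (hij : XPair X i j) : ¬ HasAnisotropic X j i := by
  rintro ⟨v, hv, hq⟩
  obtain ⟨hP, hS⟩ := hX
  have hprob := hS i j hij
  obtain ⟨hlt, hXij, hXjj⟩ := hij
  have hXji : X j i ≠ 0 := by rwa [hP.1.apply]
  rw [dotProduct_mulVec_self_eq_sum_diag hchar hP.1] at hq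
  refine hq (Finset.sum_eq_zero fun s _ => ?_)
  by_cases hss : X s s = 0
  · rw [hss, zero_mul]
  suffices v s = 0 by rw [this]; ring
  rcases le_or_gt j s with hjs | hsj
  · exact hv.1 s hjs
  obtain ⟨r, hr⟩ := exists_linked ⟨s, hss⟩
  have hrs : r ≤ s := by
    by_cases e : r = s
    · exact e.le
    · exact (hP.2.2 s r e hr.1 hss).le
  have hri : r < i := by
    by_contra! hir
    rcases eq_or_lt_of_le hir with e | hir
    · subst e
      by_cases e : i = s
      · subst e
        exact absurd (hP.2.2 i j hlt.ne' hXji hss) hlt.not_gt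
      · exact hsj.ne (hP.2.1 i s j (Ne.symm e) hlt.ne' (by rw [hP.1.apply]; exact hr.1) hXji)
    · refine hprob ?_
      by_cases e : r = s
      · exact Or.inr ⟨s, hr.2 e, e ▸ hir, hsj⟩
      · exact Or.inl ⟨r, s, ⟨lt_of_le_of_ne hrs e, hr.1, hss⟩, hir, hsj⟩
  have h0 := hv.2 r hri
  rw [mulVec_eq_of_row (a := s)] at h0
  · exact (mul_eq_zero.1 h0).resolve_left hr.1
  · intro t ht
    left
    by_contra hrt
    rw [← hP.1.apply] at hrt
    by_cases e : r = s
    · exact ht ((hr.2 e).2 t (e ▸ hrt))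
    have hsr : X s r ≠ 0 := by rw [hP.1.apply]; exact hr.1
    by_cases e' : t = r
    · subst e'
      exact absurd (hP.2.2 t s (Ne.symm e) hsr hrt) hrs.not_gt
    · exact ht (hP.2.1 r t s e' (Ne.symm e) hrt hsr)

lemma IsPseudoPerm.hasAnisotropic_of_xPair {X : Matrix (Fin n) (Fin n) F} (hX : IsPseudoPerm X)
    {i j : Fin n} (hij : XPair X i j) : HasAnisotropic X (j + 1) i := by
  obtain ⟨hlt, hXij, hXjj⟩ := hij
  refine ⟨Pi.single j 1, ⟨fun t ht => ?_, fun u hu => ?_⟩, ?_⟩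
  · rw [Pi.single_eq_of_ne]
    rintro rfl
    omega
  · rw [mulVec_single_one, col_apply]
    by_contra h0
    have hui : u < i := hu
    exact hui.ne (hX.2.1 j u i (hui.trans hlt).ne hlt.ne h0 hXij)
  · simpa using hXjj

lemma IsPseudoPerm.hasAnisotropic_of_diag_eq_zero (hchar : (2 : F) = 0)
    {X : Matrix (Fin n) (Fin n) F} (hX : IsPseudoPerm X) {i j : Fin n} (hlt : i < j)
    (hij : X i j ≠ 0) (hjj : X j j = 0) (h : HasAnisotropic X (j + 1) i) :
    HasAnisotropic X j i := by
  obtain ⟨v, hv, hq⟩ := h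
  have hne : ∀ t, t ≠ j → Function.update v j 0 t = v t := fun t ht => Function.update_of_ne ht ..
  refine ⟨Function.update v j 0, ⟨fun t ht => ?_, fun u hu => ?_⟩, ?_⟩
  · by_cases e : t = j
    · rw [e, Function.update_self]
    · rw [hne t e]
      have : (t : ℕ) ≠ j := fun e' => e (Fin.ext e')
      exact hv.1 t (by omega)
  · have hui : u < i := hu
    have huj : X u j = 0 := by
      by_contra h0
      exact hui.ne (hX.2.1 j u i (hui.trans hlt).ne hlt.ne h0 hij)
    refine Eq.trans ?_ (hv.2 u hu)
    simp only [mulVec, dotProduct]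
    refine Finset.sum_congr rfl fun t _ => ?_
    by_cases e : t = j
    · rw [e, huj, zero_mul, zero_mul]
    · rw [hne t e]
  · rw [dotProduct_mulVec_self_eq_sum_diag hchar hX.1] at hq ⊢
    convert hq using 1
    refine Finset.sum_congr rfl fun t _ => ?_
    by_cases e : t = j
    · rw [e, hjj, zero_mul, zero_mul]
    · rw [hne t e]

lemma BCongruent.apply_ne_zero (hchar : (2 : F) = 0) {X Y : Matrix (Fin n) (Fin n) F}
    (hXY : BCongruent X Y) (hX : IsSpecializedPseudoPerm X) (hY : IsSpecializedPseudoPerm Y)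
    {i j : Fin n} (hij : X i j ≠ 0) : Y i j ≠ 0 := by
  by_cases e : i = j
  · subst e
    obtain ⟨r, hr⟩ := exists_linked ⟨i, hij⟩
    have hr' := hXY.linked hX.1 hY.1 hr
    by_cases e : r = i
    · exact (hr'.2 e).1
    · have hlt := hX.1.2.2 i r e hr.1 hij
      intro h0
      have hp : XPair X r i := ⟨hlt, hr.1, hij⟩
      exact hX.not_hasAnisotropic hchar hp <| hXY.hasAnisotropic <|
        hY.1.hasAnisotropic_of_diag_eq_zero hchar hlt hr'.1 h0 <|
        hXY.symm.hasAnisotropic (hX.1.hasAnisotropic_of_xPair hp)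
  · exact (hXY.linked hX.1 hY.1 ⟨hij, fun h => absurd h e⟩).1

lemma BCongruent.eq_of_zeroOne (hchar : (2 : F) = 0) {X Y : Matrix (Fin n) (Fin n) F}
    (hXY : BCongruent X Y) (hX : IsSpecializedPseudoPerm X) (hY : IsSpecializedPseudoPerm Y)
    (hX01 : ZeroOne X) (hY01 : ZeroOne Y) : X = Y := by
  ext i j
  by_cases h : X i j = 0
  · by_contra hne
    exact hXY.symm.apply_ne_zero hchar hY hX (fun h' => hne (h.trans h'.symm)) h
  · rw [(hX01 i j).resolve_left h,
      (hY01 i j).resolve_left (hXY.apply_ne_zero hchar hX hY h)]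

/-- If `char F = 2` and every element of `F` is a square, every symmetric matrix
is `B`-congruent to a unique specialized pseudo-permutation (0,1)-matrix. -/
theorem symm_unique_specialized_zeroOne_B_congruent (hn : 2 ≤ n) (hchar : (2 : F) = 0)
    (hsq : ∀ a : F, ∃ b : F, b ^ 2 = a)
    (X : Matrix (Fin n) (Fin n) F) (hX : X.IsSymm) :
    ∃! Y : Matrix (Fin n) (Fin n) F, (IsSpecializedPseudoPerm Y ∧ ZeroOne Y) ∧
      ∃ h : Matrix (Fin n) (Fin n) F, InB h ∧ Y = hᵀ * X * h := by
  obtain ⟨Y, hXY, hY, hY01⟩ := exists_isPseudoPerm_zeroOne hsq X hX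
  obtain ⟨Z, hYZ, hZ, hZ01⟩ := exists_isSpecializedPseudoPerm hchar Y hY hY01
  have hXZ : BCongruent X Z := hXY.trans hYZ
  refine ⟨Z, ⟨⟨hZ, hZ01⟩, hXZ⟩, ?_⟩
  rintro W ⟨⟨hW, hW01⟩, hXW⟩
  exact (BCongruent.symm hXW).trans hXZ |>.eq_of_zeroOne hchar hW hZ hW01 hZ01
end

section
/- Let F be a field of characteristic 2 and let z ∈ F be an element that is not a square in F. Then the 3×3 matrix with rows (0,0,1), (0,1,0), (1,0,z) is not B-congruent to any specialized pseudo-permutation matrix. -/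
open Matrix

variable {F : Type*} [Field F] {n : ℕ}

/-- If `char F = 2` and `z` is not a square in `F`, the matrix with rows
(0,0,1), (0,1,0), (1,0,z) is not `B`-congruent to any specialized
pseudo-permutation matrix. -/
theorem not_B_congruent_specialized (hchar : (2 : F) = 0) (z : F)
    (hz : ∀ b : F, b ^ 2 ≠ z) :
    ¬ ∃ Y : Matrix (Fin 3) (Fin 3) F, IsSpecializedPseudoPerm Y ∧
      ∃ h : Matrix (Fin 3) (Fin 3) F, InB h ∧
        Y = hᵀ * !![0, 0, 1; 0, 1, 0; 1, 0, z] * h := by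
  rintro ⟨Y, ⟨⟨hsymm, hcol, -⟩, hspec⟩, h, ⟨hdet, htri⟩, hY⟩
  have h10 : h 1 0 = 0 := htri 1 0 (by decide)
  have h20 : h 2 0 = 0 := htri 2 0 (by decide)
  have h21 : h 2 1 = 0 := htri 2 1 (by decide)
  have hdet' : h 0 0 * h 1 1 * h 2 2 ≠ 0 := by
    have := hdet.ne_zero
    simpa [Matrix.det_fin_three, h10, h20, h21] using this
  have ha : h 0 0 ≠ 0 := fun H => hdet' (by simp [H])
  have hd : h 1 1 ≠ 0 := fun H => hdet' (by simp [H])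
  have hf : h 2 2 ≠ 0 := fun H => hdet' (by simp [H])
  have Y01 : Y 0 1 = 0 := by
    simp [hY, Matrix.mul_apply, Fin.sum_univ_three, h10, h20, h21]
  have Y02 : Y 0 2 ≠ 0 := by
    simp [hY, Matrix.mul_apply, Fin.sum_univ_three, h10, h20, ha, hf]
  have Y11 : Y 1 1 ≠ 0 := by
    simp [hY, Matrix.mul_apply, Fin.sum_univ_three, h21, hd]
  have Y22_eq : Y 2 2 = h 1 2 ^ 2 + z * h 2 2 ^ 2 := by
    simp [hY, Matrix.mul_apply, Fin.sum_univ_three]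
    linear_combination h 0 2 * h 2 2 * hchar
  have Y22 : Y 2 2 ≠ 0 := by
    intro H
    refine hz (h 1 2 / h 2 2) ?_
    rw [div_pow, div_eq_iff (pow_ne_zero 2 hf)]
    linear_combination H - Y22_eq - z * h 2 2 ^ 2 * hchar
  have Y12 : Y 1 2 = 0 := by
    by_contra H
    exact absurd (hcol 2 0 1 (by decide) (by decide) Y02 H) (by decide)
  have Y21 : Y 2 1 = 0 := (hsymm.apply 1 2).trans Y12
  refine hspec 0 2 ⟨by decide, Y02, Y22⟩ (Or.inr ⟨1, ⟨Y11, fun i hi => ?_⟩, by decide, by decide⟩)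
  fin_cases i
  · exact absurd Y01 hi
  · rfl
  · exact absurd Y21 hi
end

section
/- Let P be the standard parabolic subgroup of GL_n(F) determined by the indices 0 = M_0 < M_1 < ... < M_r = n. Then two n×n matrices C and D over F are P-equivalent if and only if for all 1 ≤ i, j ≤ r the rank of the M_j × M_i top-left submatrix of C equals the rank of the M_j × M_i top-left submatrix of D. -/
open Matrix

variable {F : Type*} [Field F] {n : ℕ}

/-- Membership in the standard parabolic subgroup `P` determined by
`0 = M 0 < M 1 < ... < M r = n`: invertible matrices stabilizing the span of the
first `M j` standard basis vectors for each `j ≤ r`. -/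
def InP (M : ℕ → ℕ) (r : ℕ) (g : Matrix (Fin n) (Fin n) F) : Prop :=
  IsUnit g.det ∧ ∀ j ≤ r, ∀ a b : Fin n, (b : ℕ) < M j → M j ≤ (a : ℕ) → g a b = 0

/-- The rank of the `p × q` top-left submatrix of `C`, realized as the rank of
the matrix agreeing with `C` on the top-left `p × q` corner and zero elsewhere. -/
noncomputable def topLeftRank (C : Matrix (Fin n) (Fin n) F) (p q : ℕ) : ℕ :=
  (Matrix.of fun a b : Fin n => if (a : ℕ) < p ∧ (b : ℕ) < q then C a b else 0).rank

/-- A label-preserving bijection exists between finite types with equinumerous fibers. -/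
theorem exists_equiv_of_card_fiber_eq {A B L : Type*} [Finite A] [Finite B]
    (f : A → L) (g : B → L)
    (hfg : ∀ l, Nat.card {a // f a = l} = Nat.card {b // g b = l}) :
    ∃ e : A ≃ B, ∀ a, g (e a) = f a :=
  ⟨Equiv.ofFiberEquiv fun l => (Finite.card_eq.mp (hfg l)).some,
    fun a => Equiv.ofFiberEquiv_map _ a⟩

/-- Two injections into a finite labelled type carrying the same labels differ by a
label-preserving permutation. -/
theorem exists_perm_extending {A X L : Type*} [Finite X]
    (β : X → L) {u v : A → X} (hu : u.Injective) (hv : v.Injective)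
    (huv : ∀ s, β (u s) = β (v s)) :
    ∃ σ : Equiv.Perm X, (∀ s, σ (u s) = v s) ∧ ∀ x, β (σ x) = β x := by
  classical
  have bijective_elim (w : A → X) (hw : w.Injective) :
      (Sum.elim (Subtype.val : {x // x ∉ Set.range w} → X) w).Bijective := by
    constructor
    · rintro (⟨x, hx⟩ | s) (⟨y, hy⟩ | t) h
      · simpa using h
      · exact absurd ⟨t, h.symm⟩ hx
      · exact absurd ⟨s, h⟩ hy
      · exact congrArg Sum.inr (hw h)
    · intro x
      by_cases h : x ∈ Set.range w
      · obtain ⟨s, rfl⟩ := h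
        exact ⟨Sum.inr s, rfl⟩
      · exact ⟨Sum.inl ⟨x, h⟩, rfl⟩
  let split (w : A → X) (hw : w.Injective) : {x // x ∉ Set.range w} ⊕ A ≃ X :=
    Equiv.ofBijective _ (bijective_elim w hw)
  have card_fiber (w : A → X) (hw : w.Injective) (l : L) :
      Nat.card {x : {x // x ∉ Set.range w} // β x = l} +
        Nat.card {s // β (w s) = l} = Nat.card {x // β x = l} := by
    have := Finite.of_injective w hw
    rw [← Nat.card_sum]
    exact Nat.card_congr ((Equiv.subtypeSum
      (p := fun z => β (split w hw z) = l)).symm.trans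
        ((split w hw).subtypeEquiv fun _ => Iff.rfl))
  obtain ⟨e, he⟩ := exists_equiv_of_card_fiber_eq
    (fun x : {x // x ∉ Set.range u} => β x) (fun x : {x // x ∉ Set.range v} => β x) (by
      intro l
      have h₁ := card_fiber u hu l
      have h₂ := card_fiber v hv l
      simp only [huv] at h₁
      omega)
  let σ := (split u hu).symm.trans ((e.sumCongr (Equiv.refl A)).trans (split v hv))
  have hσ (z) : σ (split u hu z) = split v hv (e.sumCongr (Equiv.refl A) z) := by simp [σ]
  refine ⟨σ, fun s => hσ (Sum.inr s), fun x => ?_⟩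
  obtain ⟨z, rfl⟩ := (split u hu).surjective x
  rw [hσ]
  rcases z with x | s
  · exact he x
  · exact (huv s).symm

/-- Equivalence under the invertible block triangular matrices with block labels `β`. -/
def BlockEquiv (β : Fin n → ℕ) (C D : Matrix (Fin n) (Fin n) F) : Prop :=
  ∃ h k : Matrix (Fin n) (Fin n) F, (IsUnit h.det ∧ h.BlockTriangular β) ∧
    (IsUnit k.det ∧ k.BlockTriangular β) ∧ D = hᵀ * C * k

namespace BlockEquiv

variable {β : Fin n → ℕ} {C D E : Matrix (Fin n) (Fin n) F}

theorem refl (β : Fin n → ℕ) (C : Matrix (Fin n) (Fin n) F) : BlockEquiv β C C :=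
  ⟨1, 1, by simp [blockTriangular_one], by simp [blockTriangular_one], by simp⟩

theorem trans (hCD : BlockEquiv β C D) (hDE : BlockEquiv β D E) : BlockEquiv β C E := by
  obtain ⟨h, k, ⟨hh, hh'⟩, ⟨hk, hk'⟩, rfl⟩ := hCD
  obtain ⟨u, v, ⟨hu, hu'⟩, ⟨hv, hv'⟩, rfl⟩ := hDE
  refine ⟨h * u, k * v, ⟨?_, hh'.mul hu'⟩, ⟨?_, hk'.mul hv'⟩, ?_⟩
  · rw [det_mul]; exact hh.mul hu
  · rw [det_mul]; exact hk.mul hv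
  · simp only [transpose_mul, Matrix.mul_assoc]

theorem symm (hCD : BlockEquiv β C D) : BlockEquiv β D C := by
  obtain ⟨h, k, ⟨hh, hh'⟩, ⟨hk, hk'⟩, rfl⟩ := hCD
  have := invertibleOfIsUnitDet h hh
  have := invertibleOfIsUnitDet k hk
  refine ⟨h⁻¹, k⁻¹, ⟨isUnit_nonsing_inv_det h hh, blockTriangular_inv_of_blockTriangular hh'⟩,
    ⟨isUnit_nonsing_inv_det k hk, blockTriangular_inv_of_blockTriangular hk'⟩, ?_⟩
  have e : (h⁻¹)ᵀ * hᵀ = 1 := by rw [← transpose_mul, mul_nonsing_inv h hh, transpose_one]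
  rw [Matrix.mul_assoc hᵀ, ← Matrix.mul_assoc, ← Matrix.mul_assoc, e, Matrix.one_mul,
    Matrix.mul_assoc, mul_nonsing_inv k hk, Matrix.mul_one]

end BlockEquiv

/-- The submatrix on rows of label `< j` and columns of label `< i`, padded by zeros. -/
def corner (β : Fin n → ℕ) (C : Matrix (Fin n) (Fin n) F) (j i : ℕ) : Matrix (Fin n) (Fin n) F :=
  Matrix.of fun a b => if β a < j ∧ β b < i then C a b else 0

theorem corner_eq_mul (β : Fin n → ℕ) (C : Matrix (Fin n) (Fin n) F) (j i : ℕ) :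
    corner β C j i = diagonal (fun a => if β a < j then 1 else 0) * C *
      diagonal (fun b => if β b < i then 1 else 0) := by
  ext a b
  simp only [corner, of_apply, mul_diagonal, diagonal_mul]
  split_ifs <;> simp_all

theorem Matrix.BlockTriangular.mul_diagonal_lt {β : Fin n → ℕ} {k : Matrix (Fin n) (Fin n) F}
    (hk : k.BlockTriangular β) (i : ℕ) :
    k * diagonal (fun b => if β b < i then 1 else 0) =
      diagonal (fun b => if β b < i then 1 else 0) *
        (k * diagonal (fun b => if β b < i then 1 else 0)) := by
  ext a b
  simp only [mul_diagonal, diagonal_mul]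
  by_cases hb : β b < i <;> by_cases ha : β a < i <;> simp [ha, hb]
  exact hk (by omega)

theorem BlockEquiv.rank_corner_le {β : Fin n → ℕ} {C D : Matrix (Fin n) (Fin n) F}
    (hCD : BlockEquiv β C D) (j i : ℕ) : (corner β D j i).rank ≤ (corner β C j i).rank := by
  obtain ⟨h, k, ⟨-, hh⟩, ⟨-, hk⟩, rfl⟩ := hCD
  have e := congrArg transpose (hh.mul_diagonal_lt j)
  simp only [transpose_mul, diagonal_transpose] at e
  have : corner β (hᵀ * C * k) j i =
      diagonal (fun a => if β a < j then 1 else 0) * hᵀ * corner β C j i *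
        (k * diagonal (fun b => if β b < i then 1 else 0)) := by
    rw [corner_eq_mul, corner_eq_mul]
    simp only [Matrix.mul_assoc] at e ⊢
    rw [← hk.mul_diagonal_lt i]
    simp only [← Matrix.mul_assoc] at e ⊢
    rw [← e]
  rw [this]
  exact (rank_mul_le_left _ _).trans (rank_mul_le_right _ _)

theorem BlockEquiv.rank_corner_eq {β : Fin n → ℕ} {C D : Matrix (Fin n) (Fin n) F}
    (hCD : BlockEquiv β C D) (j i : ℕ) : (corner β C j i).rank = (corner β D j i).rank :=
  (hCD.symm.rank_corner_le j i).antisymm (hCD.rank_corner_le j i)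

theorem blockTriangular_of_monotone {β : Fin n → ℕ} (hβ : Monotone β)
    {k : Matrix (Fin n) (Fin n) F} (hk : k.BlockTriangular id) : k.BlockTriangular β :=
  fun _ _ hab => hk (hβ.reflect_lt hab)

/-- Clearing the row and the column of a pivot by triangular operations. -/
theorem blockEquiv_pivot {β : Fin n → ℕ} (hβ : Monotone β) (C : Matrix (Fin n) (Fin n) F)
    (k c : Fin n) (hkc : C k c ≠ 0) (hrow : ∀ b < c, C k b = 0) (hcol : ∀ a < k, C a c = 0) :
    BlockEquiv β C (Matrix.of fun a b =>
      if a = k then (if b = c then 1 else 0) else C a b - C a c * C k b / C k c) := by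
  let v : Fin n → F := fun b => ((if b = c then 1 else 0) - C k b) / C k c
  let w : Fin n → F := fun a => if a = k then 0 else C a c / C k c
  have hv : ((1 : Matrix (Fin n) (Fin n) F) + vecMulVec (Pi.single c 1) v).BlockTriangular id := by
    intro a b hab
    simp only [id] at hab
    rcases eq_or_ne a c with rfl | ha
    · simp [vecMulVec_apply, v, hab.ne, hab.ne', hrow b hab]
    · simp [vecMulVec_apply, ha, hab.ne']
  have hw : ((1 : Matrix (Fin n) (Fin n) F) - vecMulVec (Pi.single k 1) w).BlockTriangular id := by
    intro a b hab
    simp only [id] at hab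
    rcases eq_or_ne a k with rfl | ha
    · simp [vecMulVec_apply, w, hab.ne, hab.ne', hcol b hab]
    · simp [vecMulVec_apply, ha, hab.ne']
  refine ⟨_, _, ⟨?_, blockTriangular_of_monotone hβ hw⟩,
    ⟨?_, blockTriangular_of_monotone hβ hv⟩, ?_⟩
  · rw [det_of_isUpperTriangular hw, isUnit_iff_ne_zero, Finset.prod_ne_zero_iff]
    intro a _
    rcases eq_or_ne a k with rfl | ha
    · simp [vecMulVec_apply, w]
    · simp [vecMulVec_apply, ha]
  · rw [det_of_isUpperTriangular hv, isUnit_iff_ne_zero, Finset.prod_ne_zero_iff]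
    intro a _
    rcases eq_or_ne a c with rfl | ha
    · have : 1 + (1 - C k a) / C k a = (C k a)⁻¹ := by field_simp; ring
      simp [vecMulVec_apply, v, this, hkc]
    · simp [vecMulVec_apply, ha]
  · have e (a b : Fin n) : (C * (1 + vecMulVec (Pi.single c 1) v)) a b = C a b + C a c * v b := by
      simp [Matrix.mul_add, mul_vecMulVec, vecMulVec_apply]
    have e' (X : Matrix (Fin n) (Fin n) F) (a b : Fin n) :
        (((1 : Matrix (Fin n) (Fin n) F) - vecMulVec (Pi.single k 1) w)ᵀ * X : Matrix (Fin n) (Fin n) F) a b = X a b - w a * X k b := by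
      simp [transpose_vecMulVec, Matrix.sub_mul, vecMulVec_mul, vecMulVec_apply]
    ext a b
    rw [Matrix.mul_assoc, e', e, e]
    simp only [of_apply, v, w]
    split_ifs <;> subst_vars <;> field_simp <;> ring

/-- The zero-one matrix with support `S`. -/
def indicatorMatrix (F : Type*) [Field F] (S : Finset (Fin n × Fin n)) :
    Matrix (Fin n) (Fin n) F :=
  Matrix.of fun a b => if (a, b) ∈ S then 1 else 0

/-- A partial permutation, as a set of positions no two of which share a row or a column. -/
def IsPartialPerm (S : Finset (Fin n × Fin n)) : Prop :=
  Set.InjOn Prod.fst (S : Set (Fin n × Fin n)) ∧ Set.InjOn Prod.snd (S : Set (Fin n × Fin n))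

theorem exists_blockEquiv_rows {β : Fin n → ℕ} (hβ : Monotone β)
    (C : Matrix (Fin n) (Fin n) F) (k : ℕ) (hk : k ≤ n) :
    ∃ (D : Matrix (Fin n) (Fin n) F) (S : Finset (Fin n × Fin n)), BlockEquiv β C D ∧
      IsPartialPerm S ∧ (∀ s ∈ S, (s.1 : ℕ) < k) ∧
      (∀ a b : Fin n, (a : ℕ) < k → D a b = if (a, b) ∈ S then 1 else 0) ∧
      ∀ a : Fin n, k ≤ a → ∀ s ∈ S, D a s.2 = 0 := by
  induction k with
  | zero => exact ⟨C, ∅, .refl β C, by simp [IsPartialPerm], by simp, by simp, by simp⟩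
  | succ k ih =>
    obtain ⟨D, S, hCD, ⟨hS₁, hS₂⟩, hSk, hD, hD0⟩ := ih (by omega)
    let k' : Fin n := ⟨k, hk⟩
    have hkS (b : Fin n) : (k', b) ∉ S := fun h => (hSk _ h).ne rfl
    by_cases hrow : ∀ b, D k' b = 0
    · refine ⟨D, S, hCD, ⟨hS₁, hS₂⟩, fun s hs => (hSk s hs).trans k.lt_succ_self,
        fun a b ha => ?_, fun a ha => hD0 a (by omega)⟩
      rcases Nat.lt_succ_iff_lt_or_eq.mp ha with ha | ha
      · exact hD a b ha
      · obtain rfl : a = k' := Fin.ext ha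
        simp [hrow, hkS]
    · push Not at hrow
      obtain ⟨c, hc, hmin⟩ := wellFounded_lt.has_min {b | D k' b ≠ 0} hrow
      have hmin (b) (hb : b < c) : D k' b = 0 := by
        by_contra h
        exact hmin b h hb
      have hcS (a) : (a, c) ∉ S := fun h => hc (hD0 k' le_rfl _ h)
      have hcol (a) (ha : a < k') : D a c = 0 := by rw [hD a c ha, if_neg (hcS a)]
      refine ⟨_, insert (k', c) S, hCD.trans (blockEquiv_pivot hβ D k' c hc hmin hcol),
        ⟨?_, ?_⟩, ?_, ?_, ?_⟩
      · rw [Finset.coe_insert, Set.injOn_insert (hkS c)]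
        refine ⟨hS₁, ?_⟩
        rintro ⟨⟨a, b⟩, hs, rfl⟩
        exact hkS b hs
      · rw [Finset.coe_insert, Set.injOn_insert (hkS c)]
        refine ⟨hS₂, ?_⟩
        rintro ⟨⟨a, b⟩, hs, rfl⟩
        exact hcS a hs
      · simp only [Finset.mem_insert, forall_eq_or_imp]
        exact ⟨k.lt_succ_self, fun s hs => (hSk s hs).trans k.lt_succ_self⟩
      · intro a b ha
        rcases eq_or_ne a k' with rfl | hak
        · simp [hkS]
        · have ha' : a < k' := lt_of_le_of_ne (Nat.lt_succ_iff.mp ha) hak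
          simp [hak, hcol a ha', hD a b ha']
      · intro a ha s hs
        have hak : a ≠ k' := by
          rintro rfl
          exact k.lt_irrefl ha
        rcases Finset.mem_insert.mp hs with rfl | hs
        · have hc : D k' c ≠ 0 := hc
          simp [hak, hc]
        · simp [hak, hD0 a (by omega) s hs, hD0 k' le_rfl s hs]

theorem exists_blockEquiv_indicatorMatrix {β : Fin n → ℕ} (hβ : Monotone β)
    (C : Matrix (Fin n) (Fin n) F) :
    ∃ S : Finset (Fin n × Fin n), IsPartialPerm S ∧ BlockEquiv β C (indicatorMatrix F S) := by
  obtain ⟨D, S, hCD, hS, -, hD, -⟩ := exists_blockEquiv_rows hβ C n le_rfl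
  refine ⟨S, hS, ?_⟩
  convert hCD
  ext a b
  rw [hD a b a.isLt]
  rfl

theorem IsPartialPerm.rank_indicatorMatrix {S : Finset (Fin n × Fin n)} (hS : IsPartialPerm S) :
    (indicatorMatrix F S).rank = S.card := by
  classical
  let d : Fin n → F := fun a => if a ∈ S.image Prod.fst then 1 else 0
  have hd : (diagonal d).rank = S.card := by
    rw [rank_diagonal, ← Finset.card_image_of_injOn hS.1, Fintype.card_subtype]
    congr 1
    ext a
    simp [d]
  have h₁ : indicatorMatrix F S = diagonal d * indicatorMatrix F S := by
    ext a b
    simp only [diagonal_mul, indicatorMatrix, of_apply, d, Finset.mem_image, Prod.exists]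
    split_ifs <;> simp_all
  have h₂ : indicatorMatrix F S * (indicatorMatrix F S)ᵀ = diagonal d := by
    ext a a'
    simp only [mul_apply, transpose_apply, indicatorMatrix, of_apply, diagonal_apply, d]
    by_cases ha : ∃ b, (a, b) ∈ S
    · obtain ⟨b, hb⟩ := ha
      rw [Finset.sum_eq_single b]
      · have h : (a', b) ∈ S ↔ a = a' :=
          ⟨fun h => congrArg Prod.fst (hS.2 hb h rfl), by rintro rfl; exact hb⟩
        have : a ∈ S.image Prod.fst := Finset.mem_image_of_mem _ hb
        simp [hb, h, this]
      · intro x _ hx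
        have : (a, x) ∉ S := fun h => hx (congrArg Prod.snd (hS.1 h hb rfl))
        simp [this]
      · simp
    · push Not at ha
      simp [ha]
  refine le_antisymm ?_ ?_
  · rw [h₁, ← hd]; exact rank_mul_le_left _ _
  · rw [← hd, ← h₂]; exact rank_mul_le_left _ _

theorem corner_indicatorMatrix (β : Fin n → ℕ) (S : Finset (Fin n × Fin n)) (j i : ℕ) :
    corner β (indicatorMatrix F S) j i =
      indicatorMatrix F (S.filter fun s => β s.1 < j ∧ β s.2 < i) := by
  ext a b
  simp only [corner, indicatorMatrix, of_apply, Finset.mem_filter]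
  split_ifs <;> simp_all

theorem IsPartialPerm.rank_corner {S : Finset (Fin n × Fin n)} (hS : IsPartialPerm S)
    (β : Fin n → ℕ) (j i : ℕ) : (corner β (indicatorMatrix F S) j i).rank =
      (S.filter fun s => β s.1 < j ∧ β s.2 < i).card := by
  rw [corner_indicatorMatrix, IsPartialPerm.rank_indicatorMatrix]
  have hsub := Finset.coe_subset.mpr (S.filter_subset fun s => β s.1 < j ∧ β s.2 < i)
  exact ⟨hS.1.mono hsub, hS.2.mono hsub⟩

/-- Cumulative counts of a labelling determine the counts of its fibers. -/
theorem card_filter_eq_of_card_filter_lt {A : Type*} (S T : Finset A) (f : A → ℕ)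
    (h : ∀ j, (S.filter fun s => f s < j).card = (T.filter fun s => f s < j).card) (j : ℕ) :
    (S.filter fun s => f s = j).card = (T.filter fun s => f s = j).card := by
  have key (U : Finset A) : (U.filter fun s => f s < j + 1).card =
      (U.filter fun s => f s < j).card + (U.filter fun s => f s = j).card := by
    classical
    rw [← Finset.card_union_of_disjoint, ← Finset.filter_or]
    · simp only [Nat.lt_succ_iff_lt_or_eq]
    · exact Finset.disjoint_filter.mpr fun _ _ h => h.ne
  have := key S
  have := key T
  have := h j
  have := h (j + 1)
  omega

theorem card_filter_labels_eq {β : Fin n → ℕ} {S T : Finset (Fin n × Fin n)}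
    (h : ∀ j i, (S.filter fun s => β s.1 < j ∧ β s.2 < i).card =
      (T.filter fun s => β s.1 < j ∧ β s.2 < i).card) (j i : ℕ) :
    (S.filter fun s => β s.1 = j ∧ β s.2 = i).card =
      (T.filter fun s => β s.1 = j ∧ β s.2 = i).card := by
  have h' (i) := card_filter_eq_of_card_filter_lt (S.filter fun s => β s.2 < i)
    (T.filter fun s => β s.2 < i) (fun s => β s.1)
    (fun j => by simpa only [Finset.filter_filter, and_comm] using h j i) j
  simpa only [Finset.filter_filter] using card_filter_eq_of_card_filter_lt
    (S.filter fun s => β s.1 = j) (T.filter fun s => β s.1 = j) (fun s => β s.2)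
    (fun i => by simpa only [Finset.filter_filter, and_comm] using h' i) i

theorem blockEquiv_indicatorMatrix {β : Fin n → ℕ} {S T : Finset (Fin n × Fin n)}
    (hS : IsPartialPerm S) (hT : IsPartialPerm T)
    (h : ∀ j i, (S.filter fun s => β s.1 = j ∧ β s.2 = i).card =
      (T.filter fun s => β s.1 = j ∧ β s.2 = i).card) :
    BlockEquiv β (indicatorMatrix F S) (indicatorMatrix F T) := by
  obtain ⟨e, he⟩ := exists_equiv_of_card_fiber_eq (fun s : S => (β s.1.1, β s.1.2))
    (fun s : T => (β s.1.1, β s.1.2)) (by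
      rintro ⟨j, i⟩
      have key (U : Finset (Fin n × Fin n)) :
          Nat.card {s : U // (β s.1.1, β s.1.2) = (j, i)} =
            (U.filter fun s => β s.1 = j ∧ β s.2 = i).card := by
        rw [Nat.card_eq_fintype_card, Fintype.card_subtype,
          ← Finset.card_map (Function.Embedding.subtype _)]
        congr 1
        ext s
        rw [Finset.mem_map, Finset.mem_filter]
        constructor
        · rintro ⟨x, hx, rfl⟩
          exact ⟨x.2, by simpa using hx⟩
        · rintro ⟨hs, hx⟩
          exact ⟨⟨s, hs⟩, by simpa using hx, rfl⟩
      rw [key, key, h])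
  simp only [Prod.mk.injEq] at he
  obtain ⟨σ, hσ, hσβ⟩ := exists_perm_extending β (u := fun s : S => s.1.1)
    (v := fun s : S => (e s).1.1) (fun s t hst => Subtype.ext (hS.1 s.2 t.2 hst))
    (fun s t hst => e.injective (Subtype.ext (hT.1 (e s).2 (e t).2 hst))) (fun s => (he s).1.symm)
  obtain ⟨τ, hτ, hτβ⟩ := exists_perm_extending β (u := fun s : S => s.1.2)
    (v := fun s : S => (e s).1.2) (fun s t hst => Subtype.ext (hS.2 s.2 t.2 hst))
    (fun s t hst => e.injective (Subtype.ext (hT.2 (e s).2 (e t).2 hst))) (fun s => (he s).2.symm)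
  have hST (a b : Fin n) : (a, b) ∈ S ↔ (σ a, τ b) ∈ T := by
    constructor
    · intro hab
      have h₁ := hσ ⟨_, hab⟩
      have h₂ := hτ ⟨_, hab⟩
      simp only at h₁ h₂
      rw [h₁, h₂]
      exact (e _).2
    · intro hab
      obtain ⟨⟨⟨a', b'⟩, hs⟩, hes⟩ := e.surjective ⟨_, hab⟩
      have h₁ := hσ ⟨_, hs⟩
      have h₂ := hτ ⟨_, hs⟩
      simp only [hes, EmbeddingLike.apply_eq_iff_eq] at h₁ h₂
      rwa [← h₁, ← h₂]
  have htri (ρ : Equiv.Perm (Fin n)) (hρ : ∀ x, β (ρ x) = β x) :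
      IsUnit (ρ.permMatrix F).det ∧ (ρ.permMatrix F).BlockTriangular β := by
    constructor
    · rw [det_permutation]
      exact (Units.isUnit (Equiv.Perm.sign ρ)).map (Int.castRingHom F)
    · intro a b hab
      rw [Equiv.Perm.permMatrix, PEquiv.toMatrix_apply, if_neg]
      simp only [Equiv.toPEquiv_apply, Option.mem_some_iff]
      rintro rfl
      exact hab.ne (hρ a)
  refine ⟨σ.permMatrix F, τ.permMatrix F, htri σ hσβ, htri τ hτβ, ?_⟩
  rw [transpose_permMatrix]
  ext a b
  simp [indicatorMatrix, Equiv.Perm.permMatrix, hST, PEquiv.toMatrix_toPEquiv_mul,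
    PEquiv.mul_toMatrix_toPEquiv]

theorem blockEquiv_iff_rank_corner {β : Fin n → ℕ} (hβ : Monotone β)
    (C D : Matrix (Fin n) (Fin n) F) :
    BlockEquiv β C D ↔ ∀ j i, (corner β C j i).rank = (corner β D j i).rank := by
  refine ⟨fun h => h.rank_corner_eq, fun h => ?_⟩
  obtain ⟨S, hS, hCS⟩ := exists_blockEquiv_indicatorMatrix hβ C
  obtain ⟨T, hT, hDT⟩ := exists_blockEquiv_indicatorMatrix hβ D
  refine (hCS.trans (blockEquiv_indicatorMatrix hS hT (card_filter_labels_eq fun j i => ?_))).trans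
    hDT.symm
  rw [← hS.rank_corner (F := F), ← hT.rank_corner (F := F), ← hCS.rank_corner_eq,
    ← hDT.rank_corner_eq, h]

/-- The block index function of a composition of `n`. -/
theorem exists_block_index {r : ℕ} {M : ℕ → ℕ} (hM0 : M 0 = 0)
    (hMmono : ∀ i < r, M i < M (i + 1)) :
    ∃ β : ℕ → ℕ, ∀ a, ∀ j ≤ r, a < M j ↔ β a < j := by
  have hmono : MonotoneOn M (Set.Iic r) := by
    intro i _ j hj hij
    induction j, hij using Nat.le_induction with
    | base => exact le_rfl
    | succ j _ ih =>
      have hj' : j < r := hj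
      exact (ih hj'.le).trans (hMmono j hj').le
  refine ⟨fun a => Nat.findGreatest (fun j => M j ≤ a) r, fun a j hj => ?_⟩
  rw [← not_iff_not, not_lt, not_lt]
  refine ⟨fun h => Nat.le_findGreatest hj h, fun h => ?_⟩
  have := Nat.findGreatest_spec (P := fun j => M j ≤ a) (Nat.zero_le r) (by simp [hM0])
  exact (hmono hj (Nat.findGreatest_le r) h).trans this

/-- Two matrices are `P`-equivalent iff the ranks of all the corresponding
`M j × M i` top-left submatrices coincide. -/
theorem P_equivalent_iff_topLeft_ranks (hn : 2 ≤ n) (r : ℕ) (M : ℕ → ℕ)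
    (hM0 : M 0 = 0) (hMr : M r = n) (hMmono : ∀ i < r, M i < M (i + 1))
    (C D : Matrix (Fin n) (Fin n) F) :
    (∃ h k : Matrix (Fin n) (Fin n) F, InP M r h ∧ InP M r k ∧ D = hᵀ * C * k) ↔
      ∀ i j : ℕ, 1 ≤ i → i ≤ r → 1 ≤ j → j ≤ r →
        topLeftRank C (M j) (M i) = topLeftRank D (M j) (M i) := by
  obtain ⟨γ, hγ⟩ := exists_block_index hM0 hMmono
  let β : Fin n → ℕ := fun a => γ a
  have hβr (a : Fin n) : β a < r := (hγ a r le_rfl).mp (hMr ▸ a.isLt)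
  have hβ : Monotone β := by
    intro a b hab
    by_contra! hlt
    have h₁ := (hγ b (β a) (hβr a).le).mpr hlt
    have h₂ := (hγ a (β a) (hβr a).le).mp (lt_of_le_of_lt hab h₁)
    exact lt_irrefl _ h₂
  have hP (g : Matrix (Fin n) (Fin n) F) : InP M r g ↔ IsUnit g.det ∧ g.BlockTriangular β := by
    refine and_congr_right fun _ => ⟨fun h a b hab => ?_, fun h j hj a b hb ha => h ?_⟩
    · refine h (β a) (hβr a).le a b ((hγ b _ (hβr a).le).mpr hab) (not_lt.mp fun hlt => ?_)
      exact lt_irrefl _ ((hγ a _ (hβr a).le).mp hlt)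
    · exact ((hγ b j hj).mp hb).trans_le (not_lt.mp fun hlt => ha.not_gt ((hγ a j hj).mpr hlt))
  have hrank (X : Matrix (Fin n) (Fin n) F) {i j : ℕ} (hi : i ≤ r) (hj : j ≤ r) :
      topLeftRank X (M j) (M i) = (corner β X j i).rank := by
    simp only [topLeftRank, corner, hγ _ _ hi, hγ _ _ hj, β]
  have hmin (X : Matrix (Fin n) (Fin n) F) (i j : ℕ) :
      corner β X j i = corner β X (min j r) (min i r) := by
    simp only [corner, lt_min_iff, hβr, and_true]
  have hzero (X : Matrix (Fin n) (Fin n) F) (i j : ℕ) (hij : i = 0 ∨ j = 0) :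
      corner β X j i = 0 := by
    ext a b
    rcases hij with rfl | rfl <;> simp [corner]
  simp only [hP]
  refine (blockEquiv_iff_rank_corner hβ C D).trans ⟨fun h i j _ hi _ hj => ?_, fun h j i => ?_⟩
  · rw [hrank C hi hj, hrank D hi hj, h]
  · rw [hmin C, hmin D]
    by_cases hij : min i r = 0 ∨ min j r = 0
    · rw [hzero _ _ _ hij, hzero _ _ _ hij]
    · push Not at hij
      rw [← hrank C (min_le_right _ _) (min_le_right _ _),
        ← hrank D (min_le_right _ _) (min_le_right _ _)]
      exact h _ _ (Nat.one_le_iff_ne_zero.mpr hij.1) (min_le_right _ _)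
        (Nat.one_le_iff_ne_zero.mpr hij.2) (min_le_right _ _)
end

section
/- Suppose the characteristic of the field F is not 2 and every element of F is a square. Let P be the standard parabolic subgroup of GL_n(F) determined by the indices 0 = M_0 < M_1 < ... < M_r = n. Then two symmetric n×n matrices C and D over F are P-congruent if and only if they are P-equivalent. -/
open Matrix

variable {F : Type*} [Field F] {n : ℕ}

section FlagCongruence

variable {ι : Type*} [Fintype ι] [DecidableEq ι]

/-- Invertible matrices preserving the flag cut out by the level function `ℓ`, whose rows and
columns indexed by `S` are those of the identity matrix. -/
structure IsFlagAut (ℓ : ι → ℕ) (S : Finset ι) (g : Matrix ι ι F) : Prop where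
  isUnit_det : IsUnit g.det
  blockTriangular : g.BlockTriangular ℓ
  row_eq : ∀ a ∈ S, ∀ b, g a b = (1 : Matrix ι ι F) a b
  col_eq : ∀ b ∈ S, ∀ a, g a b = (1 : Matrix ι ι F) a b

/-- Congruence under the group of flag automorphisms fixing `S`. -/
def FlagCongr (ℓ : ι → ℕ) (S : Finset ι) (C D : Matrix ι ι F) : Prop :=
  ∃ g, IsFlagAut ℓ S g ∧ D = gᵀ * C * g

variable {ℓ : ι → ℕ} {S : Finset ι} {C D E g h : Matrix ι ι F}

namespace IsFlagAut

theorem mul_row (hg : IsFlagAut ℓ S g) (X : Matrix ι ι F) {a : ι} (ha : a ∈ S) (b : ι) :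
    (g * X) a b = X a b := by
  simp [Matrix.mul_apply, hg.row_eq a ha, Matrix.one_apply]

theorem mul_col (hg : IsFlagAut ℓ S g) (X : Matrix ι ι F) {b : ι} (hb : b ∈ S) (a : ι) :
    (X * g) a b = X a b := by
  simp [Matrix.mul_apply, hg.col_eq b hb, Matrix.one_apply]

theorem one : IsFlagAut ℓ S (1 : Matrix ι ι F) :=
  ⟨by simp, blockTriangular_one, fun _ _ _ => rfl, fun _ _ _ => rfl⟩

theorem mul (hg : IsFlagAut ℓ S g) (hh : IsFlagAut ℓ S h) : IsFlagAut ℓ S (g * h) where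
  isUnit_det := by rw [det_mul]; exact hg.isUnit_det.mul hh.isUnit_det
  blockTriangular := hg.blockTriangular.mul hh.blockTriangular
  row_eq a ha b := by rw [hg.mul_row h ha, hh.row_eq a ha]
  col_eq b hb a := by rw [hh.mul_col g hb, hg.col_eq b hb]

theorem inv (hg : IsFlagAut ℓ S g) : IsFlagAut ℓ S g⁻¹ where
  isUnit_det := isUnit_nonsing_inv_det g hg.isUnit_det
  blockTriangular := by
    have := g.invertibleOfIsUnitDet hg.isUnit_det
    exact blockTriangular_inv_of_blockTriangular hg.blockTriangular
  row_eq a ha b := by rw [← hg.mul_row g⁻¹ ha, mul_nonsing_inv g hg.isUnit_det]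
  col_eq b hb a := by rw [← hg.mul_col g⁻¹ hb, nonsing_inv_mul g hg.isUnit_det]

theorem mono {T : Finset ι} (hST : S ⊆ T) (hg : IsFlagAut ℓ T g) : IsFlagAut ℓ S g :=
  ⟨hg.isUnit_det, hg.blockTriangular, fun a ha => hg.row_eq a (hST ha),
    fun b hb => hg.col_eq b (hST hb)⟩

theorem transpose_mul_mul_self (hg : IsFlagAut ℓ S g)
    (hrow : ∀ a b, a ∉ S → E a b = 0) (hcol : ∀ a b, b ∉ S → E a b = 0) :
    gᵀ * E * g = E := by
  have h₁ : E * g = E := by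
    ext a b
    rw [Matrix.mul_apply, Finset.sum_eq_single b]
    · by_cases hb : b ∈ S
      · simp [hg.row_eq b hb]
      · simp [hcol a b hb]
    · intro k _ hk
      by_cases hkS : k ∈ S
      · simp [hg.row_eq k hkS, hk]
      · simp [hcol a k hkS]
    · simp
  rw [Matrix.mul_assoc, h₁]
  ext a b
  rw [Matrix.mul_apply, Finset.sum_eq_single a]
  · by_cases ha : a ∈ S
    · simp [hg.row_eq a ha]
    · simp [hrow a b ha]
  · intro k _ hk
    by_cases hkS : k ∈ S
    · simp [hg.row_eq k hkS, hk]
    · simp [hrow k b hkS]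
  · simp

end IsFlagAut

namespace FlagCongr

theorem refl : FlagCongr ℓ S C C := ⟨1, .one, by simp⟩

theorem trans (h₁ : FlagCongr ℓ S C D) (h₂ : FlagCongr ℓ S D E) : FlagCongr ℓ S C E := by
  obtain ⟨g, hg, rfl⟩ := h₁
  obtain ⟨h, hh, rfl⟩ := h₂
  exact ⟨g * h, hg.mul hh, by simp only [Matrix.transpose_mul, Matrix.mul_assoc]⟩

theorem symm (h₁ : FlagCongr ℓ S C D) : FlagCongr ℓ S D C := by
  obtain ⟨g, hg, rfl⟩ := h₁
  refine ⟨g⁻¹, hg.inv, ?_⟩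
  have h₁ : g * g⁻¹ = 1 := mul_nonsing_inv g hg.isUnit_det
  have h₂ : (g⁻¹)ᵀ * gᵀ = 1 := by rw [← Matrix.transpose_mul, h₁, Matrix.transpose_one]
  calc C = ((g⁻¹)ᵀ * gᵀ) * C * (g * g⁻¹) := by simp [h₁, h₂]
    _ = _ := by simp only [Matrix.mul_assoc]

theorem isSymm (h₁ : FlagCongr ℓ S C D) (hC : C.IsSymm) : D.IsSymm := by
  obtain ⟨g, -, rfl⟩ := h₁
  simp [Matrix.IsSymm, Matrix.transpose_mul, hC.eq, Matrix.mul_assoc]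

theorem row_eq_zero (h₁ : FlagCongr ℓ S C D) (hC : ∀ a ∈ S, ∀ b, C a b = 0) :
    ∀ a ∈ S, ∀ b, D a b = 0 := by
  obtain ⟨g, hg, rfl⟩ := h₁
  intro a ha b
  rw [Matrix.mul_assoc, Matrix.mul_apply]
  simp [hg.col_eq a ha, Matrix.one_apply, Matrix.mul_apply, hC a ha]

theorem add_of_support {T : Finset ι} (hST : S ⊆ T) (h₁ : FlagCongr ℓ T C D)
    (hrow : ∀ a b, a ∉ T → E a b = 0) (hcol : ∀ a b, b ∉ T → E a b = 0) :
    FlagCongr ℓ S (E + C) (E + D) := by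
  obtain ⟨g, hg, rfl⟩ := h₁
  refine ⟨g, hg.mono hST, ?_⟩
  rw [Matrix.mul_add, Matrix.add_mul, hg.transpose_mul_mul_self hrow hcol]

/-- Replacing each basis vector `e b` by `e b + c b • e p`. -/
theorem elementary {p : ι} {c : ι → F} (hp : p ∉ S) (hc : 1 + c p ≠ 0)
    (hℓ : ∀ b, c b ≠ 0 → ℓ p ≤ ℓ b) (hcS : ∀ b ∈ S, c b = 0) (D : Matrix ι ι F) :
    FlagCongr ℓ S D
      (Matrix.of fun a b => D a b + c a * D p b + c b * D a p + c a * c b * D p p) := by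
  set g : Matrix ι ι F := 1 + replicateCol Unit (Pi.single p (1 : F)) * replicateRow Unit c with hg
  have hgab (a b : ι) : g a b = (1 : Matrix ι ι F) a b + if a = p then c b else 0 := by
    simp [hg, Matrix.mul_apply, Pi.single_apply]
  refine ⟨g, ⟨?_, ?_, ?_, ?_⟩, ?_⟩
  · rw [hg, det_one_add_replicateCol_mul_replicateRow]
    simpa using hc
  · intro a b hab
    have hne : a ≠ b := by rintro rfl; exact lt_irrefl _ hab
    rw [hgab, Matrix.one_apply_ne hne]
    split_ifs with h
    · subst h
      by_contra h0
      exact absurd (hℓ b (by simpa using h0)) (not_le.2 hab)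
    · simp
  · intro a ha b
    have : a ≠ p := by rintro rfl; exact hp ha
    simp [hgab, this]
  · intro b hb a
    simp [hgab, hcS b hb]
  · have h₁ (a b : ι) : (D * g) a b = D a b + c b * D a p := by
      simp [Matrix.mul_apply, hgab, mul_add, Finset.sum_add_distrib, Matrix.one_apply, mul_comm]
    ext a b
    rw [Matrix.mul_assoc, Matrix.mul_apply]
    simp only [Matrix.transpose_apply, hgab, h₁, add_mul, Finset.sum_add_distrib,
      Matrix.one_apply, ite_mul, one_mul, zero_mul, Finset.sum_ite_eq', Finset.mem_univ, if_true,
      Matrix.of_apply]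
    ring

end FlagCongr

/-- The `0`-`1` diagonal matrix selecting the coordinates of level at most `x`. -/
def levelProj (F : Type*) [Field F] (ℓ : ι → ℕ) (x : ℕ) : Matrix ι ι F :=
  diagonal fun a => if ℓ a ≤ x then 1 else 0

/-- The rank of the restriction of a bilinear form to two members of the flag. -/
noncomputable def levelRank (ℓ : ι → ℕ) (C : Matrix ι ι F) (x y : ℕ) : ℕ :=
  (levelProj F ℓ x * C * levelProj F ℓ y).rank

theorem levelProj_mul_mul_apply (x y : ℕ) (a b : ι) :
    (levelProj F ℓ x * C * levelProj F ℓ y) a b = if ℓ a ≤ x ∧ ℓ b ≤ y then C a b else 0 := by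
  rw [levelProj, levelProj, mul_diagonal, diagonal_mul]
  split_ifs <;> simp_all

theorem Matrix.BlockTriangular.mul_levelProj (hg : g.BlockTriangular ℓ) (x : ℕ) :
    g * levelProj F ℓ x = levelProj F ℓ x * g * levelProj F ℓ x := by
  ext a b
  rw [levelProj_mul_mul_apply, levelProj, mul_diagonal]
  by_cases hb : ℓ b ≤ x
  · by_cases ha : ℓ a ≤ x
    · simp [ha, hb]
    · simp [ha, hg (show ℓ b < ℓ a by omega)]
  · simp [hb]

theorem levelRank_mul_mul_le (hg : g.BlockTriangular ℓ) (hh : h.BlockTriangular ℓ)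
    (C : Matrix ι ι F) (x y : ℕ) : levelRank ℓ (gᵀ * C * h) x y ≤ levelRank ℓ C x y := by
  have hT : levelProj F ℓ x * gᵀ = levelProj F ℓ x * gᵀ * levelProj F ℓ x := by
    have := congrArg Matrix.transpose (hg.mul_levelProj x)
    simpa [Matrix.transpose_mul, levelProj, Matrix.mul_assoc] using this
  have : levelProj F ℓ x * (gᵀ * C * h) * levelProj F ℓ y =
      (levelProj F ℓ x * gᵀ) * (levelProj F ℓ x * C * levelProj F ℓ y) *
        (h * levelProj F ℓ y) := by
    calc _ = (levelProj F ℓ x * gᵀ) * C * (h * levelProj F ℓ y) := by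
          simp only [Matrix.mul_assoc]
      _ = _ := by
          rw [hT, hh.mul_levelProj y]
          simp only [Matrix.mul_assoc]
          have hxx : levelProj F ℓ x * levelProj F ℓ x = levelProj F ℓ x := by
            simp [levelProj]
          have hyy : levelProj F ℓ y * levelProj F ℓ y = levelProj F ℓ y := by
            simp [levelProj]
          simp only [← Matrix.mul_assoc]
          rw [Matrix.mul_assoc _ (levelProj F ℓ x) (levelProj F ℓ x), hxx,
            Matrix.mul_assoc _ (levelProj F ℓ y) (levelProj F ℓ y), hyy]
  rw [levelRank, this]
  exact (rank_mul_le_left _ _).trans (rank_mul_le_right _ _)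

/-- Equivalence under flag automorphisms preserves the ranks. -/
theorem levelRank_mul_mul (hg : IsFlagAut ℓ S g) (hh : IsFlagAut ℓ S h)
    (C : Matrix ι ι F) (x y : ℕ) : levelRank ℓ (gᵀ * C * h) x y = levelRank ℓ C x y := by
  refine le_antisymm (levelRank_mul_mul_le hg.blockTriangular hh.blockTriangular C x y) ?_
  have h₁ : g * g⁻¹ = 1 := mul_nonsing_inv g hg.isUnit_det
  have h₂ : (g⁻¹)ᵀ * gᵀ = 1 := by rw [← Matrix.transpose_mul, h₁, Matrix.transpose_one]
  have h₃ : h * h⁻¹ = 1 := mul_nonsing_inv h hh.isUnit_det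
  have : C = (g⁻¹)ᵀ * (gᵀ * C * h) * h⁻¹ := by
    calc C = ((g⁻¹)ᵀ * gᵀ) * C * (h * h⁻¹) := by simp [h₂, h₃]
      _ = _ := by simp only [Matrix.mul_assoc]
  conv_lhs => rw [this]
  exact levelRank_mul_mul_le hg.inv.blockTriangular hh.inv.blockTriangular _ x y

theorem FlagCongr.levelRank_eq (h₁ : FlagCongr ℓ S C D) (x y : ℕ) :
    levelRank ℓ D x y = levelRank ℓ C x y := by
  obtain ⟨g, hg, rfl⟩ := h₁
  exact levelRank_mul_mul hg hg C x y

theorem Matrix.rank_eq_zero_iff_eq_zero (A : Matrix ι ι F) : A.rank = 0 ↔ A = 0 := by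
  rw [Matrix.rank, Submodule.finrank_eq_zero, LinearMap.range_eq_bot]
  constructor
  · intro h
    ext a b
    have := congrFun (LinearMap.congr_fun h (Pi.single b 1)) a
    simpa using this
  · rintro rfl
    ext; simp

/-- Rank is additive on orthogonal direct sums. -/
theorem Matrix.rank_add_of_support {A B : Matrix ι ι F}
    (hAr : ∀ a b, a ∉ S → A a b = 0) (hAc : ∀ a b, b ∉ S → A a b = 0)
    (hBr : ∀ a b, a ∈ S → B a b = 0) (hBc : ∀ a b, b ∈ S → B a b = 0) :
    (A + B).rank = A.rank + B.rank := by
  have hAv (v : ι → F) (a : ι) (ha : a ∉ S) : (A *ᵥ v) a = 0 := by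
    simp [Matrix.mulVec, dotProduct, hAr a _ ha]
  have hBv (v : ι → F) (a : ι) (ha : a ∈ S) : (B *ᵥ v) a = 0 := by
    simp [Matrix.mulVec, dotProduct, hBr a _ ha]
  have hsup : (A + B).mulVecLin.range = A.mulVecLin.range ⊔ B.mulVecLin.range := by
    apply le_antisymm
    · rintro _ ⟨v, rfl⟩
      rw [Matrix.mulVecLin_add, LinearMap.add_apply]
      exact Submodule.add_mem_sup ⟨v, rfl⟩ ⟨v, rfl⟩
    · rw [sup_le_iff]
      constructor
      · rintro _ ⟨v, rfl⟩
        refine ⟨fun b => if b ∈ S then v b else 0, ?_⟩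
        ext a
        simp only [Matrix.mulVecLin_apply, Matrix.mulVec, dotProduct, Matrix.add_apply]
        refine Finset.sum_congr rfl fun b _ => ?_
        by_cases hb : b ∈ S
        · simp [hb, hBc a b hb]
        · simp [hb, hAc a b hb]
      · rintro _ ⟨v, rfl⟩
        refine ⟨fun b => if b ∈ S then 0 else v b, ?_⟩
        ext a
        simp only [Matrix.mulVecLin_apply, Matrix.mulVec, dotProduct, Matrix.add_apply]
        refine Finset.sum_congr rfl fun b _ => ?_
        by_cases hb : b ∈ S
        · simp [hb, hBc a b hb]
        · simp [hb, hAc a b hb]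
  have hinf : A.mulVecLin.range ⊓ B.mulVecLin.range = ⊥ := by
    rw [eq_bot_iff]
    rintro w ⟨⟨u, hu⟩, ⟨v, hv⟩⟩
    rw [Submodule.mem_bot]
    ext a
    by_cases ha : a ∈ S
    · rw [← hv]; exact hBv v a ha
    · rw [← hu]; exact hAv u a ha
  have := Submodule.finrank_sup_add_finrank_inf_eq A.mulVecLin.range B.mulVecLin.range
  rw [hinf, finrank_bot, add_zero, ← hsup] at this
  exact this

theorem levelRank_add_of_support
    (hEr : ∀ a b, a ∉ S → E a b = 0) (hEc : ∀ a b, b ∉ S → E a b = 0)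
    (hCr : ∀ a b, a ∈ S → C a b = 0) (hCc : ∀ a b, b ∈ S → C a b = 0) (x y : ℕ) :
    levelRank ℓ (E + C) x y = levelRank ℓ E x y + levelRank ℓ C x y := by
  rw [levelRank, Matrix.mul_add, Matrix.add_mul, Matrix.rank_add_of_support (S := S)]
  · rfl
  all_goals
    intro a b hab
    rw [levelProj_mul_mul_apply]
    simp [*]

theorem levelRank_ne_zero_iff (x y : ℕ) :
    levelRank ℓ C x y ≠ 0 ↔ ∃ a b, ℓ a ≤ x ∧ ℓ b ≤ y ∧ C a b ≠ 0 := by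
  rw [levelRank, Ne, Matrix.rank_eq_zero_iff_eq_zero, ← Matrix.ext_iff]
  push Not
  simp only [levelProj_mul_mul_apply, Matrix.zero_apply, ite_eq_right_iff, ne_eq]
  push Not
  simp only [and_assoc]

/-- All nonzero entries of `D` occur at pairs of levels lexicographically at least `(x, y)`. -/
def LevelsGE (ℓ : ι → ℕ) (x y : ℕ) (D : Matrix ι ι F) : Prop :=
  ∀ a b, D a b ≠ 0 → x < ℓ a ∨ x = ℓ a ∧ y ≤ ℓ b

theorem LevelsGE.of_levelRank_eq {x y : ℕ} (hC : LevelsGE ℓ x y C)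
    (hr : ∀ x y, levelRank ℓ C x y = levelRank ℓ D x y) : LevelsGE ℓ x y D := by
  intro a b hab
  have : levelRank ℓ C (ℓ a) (ℓ b) ≠ 0 := by
    rw [hr, levelRank_ne_zero_iff]
    exact ⟨a, b, le_rfl, le_rfl, hab⟩
  obtain ⟨k, l, hk, hl, hkl⟩ := (levelRank_ne_zero_iff _ _).1 this
  have := hC k l hkl
  omega

theorem LevelsGE.congr {x y : ℕ} (hC : LevelsGE ℓ x y C) (h₁ : FlagCongr ℓ S C D) :
    LevelsGE ℓ x y D :=
  hC.of_levelRank_eq fun x y => (h₁.levelRank_eq x y).symm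

theorem LevelsGE.exists_ne_zero {x y : ℕ} (hD : LevelsGE ℓ x y D) (h0 : levelRank ℓ D x y ≠ 0) :
    ∃ a b, ℓ a = x ∧ ℓ b = y ∧ D a b ≠ 0 := by
  obtain ⟨a, b, ha, hb, hab⟩ := (levelRank_ne_zero_iff _ _).1 h0
  have := hD a b hab
  exact ⟨a, b, by omega, by omega, hab⟩

omit [DecidableEq ι] in
theorem exists_levelsGE (hC : C ≠ 0) : ∃ i j, C i j ≠ 0 ∧ LevelsGE ℓ (ℓ i) (ℓ j) C := by
  obtain ⟨i₀, j₀, h₀⟩ : ∃ i j, C i j ≠ 0 := by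
    by_contra! h
    exact hC (Matrix.ext h)
  classical
  obtain ⟨⟨i, j⟩, hij, hmin⟩ := Finset.exists_min_image
    (Finset.univ.filter fun p : ι × ι => C p.1 p.2 ≠ 0)
    (fun p => toLex (ℓ p.1, ℓ p.2)) ⟨(i₀, j₀), by simpa using h₀⟩
  refine ⟨i, j, by simpa using hij, fun a b hab => ?_⟩
  have := hmin (a, b) (by simpa using hab)
  simpa [Prod.Lex.le_iff] using this

omit [Fintype ι] [DecidableEq ι] in
theorem notMem_of_ne_zero (hS : ∀ a ∈ S, ∀ b, D a b = 0) {a b : ι} (hab : D a b ≠ 0) : a ∉ S :=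
  fun ha => hab (hS a ha b)

/-- A nonzero entry in the diagonal block of `i` can be moved to the position `(i, i)`. -/
theorem exists_congr_diag_ne_zero (h2 : (2 : F) ≠ 0) (hD : D.IsSymm)
    (hS : ∀ a ∈ S, ∀ b, D a b = 0) {i : ι} (hi : i ∉ S)
    (hne : ∃ a b, ℓ a = ℓ i ∧ ℓ b = ℓ i ∧ D a b ≠ 0) :
    ∃ D', FlagCongr ℓ S D D' ∧ D' i i ≠ 0 := by
  have key (D : Matrix ι ι F) (hD : D.IsSymm) (hS : ∀ a ∈ S, ∀ b, D a b = 0)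
      (hne : ∃ a, ℓ a = ℓ i ∧ D a a ≠ 0) : ∃ D', FlagCongr ℓ S D D' ∧ D' i i ≠ 0 := by
    obtain ⟨a, ha, haa⟩ := hne
    by_cases hii : D i i = 0
    · have hia : a ≠ i := by rintro rfl; exact haa hii
      have step (t : F) : FlagCongr ℓ S D _ :=
        FlagCongr.elementary (ℓ := ℓ) (p := a) (c := Pi.single i t) (notMem_of_ne_zero hS haa)
          (by simp [hia])
          (fun b hb => by
            rcases eq_or_ne b i with rfl | hbi
            · exact ha.le
            · simp [hbi] at hb)
          (fun b hb => Pi.single_eq_of_ne (by rintro rfl; exact hi hb) _) D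
      by_contra! hall
      have h₁ := hall _ (step 1)
      have h₂ := hall _ (step (-1))
      simp only [Matrix.of_apply, Pi.single_eq_same, hii, hD.apply a i] at h₁ h₂
      exact haa ((mul_eq_zero.1 (show 2 * D a a = 0 by linear_combination h₁ + h₂)).resolve_left h2)
    · exact ⟨D, .refl, hii⟩
  obtain ⟨a, b, ha, hb, hab⟩ := hne
  by_cases haa : D a a = 0
  · by_cases hbb : D b b = 0
    · have hne : b ≠ a := by rintro rfl; exact hab haa
      have hbS : b ∉ S := notMem_of_ne_zero hS (b := a) (by rwa [hD.apply])
      have haS : a ∉ S := notMem_of_ne_zero hS hab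
      have step : FlagCongr ℓ S D _ :=
        FlagCongr.elementary (ℓ := ℓ) (p := b) (c := Pi.single a 1) hbS (by simp [hne])
          (fun k hk => by
            rcases eq_or_ne k a with rfl | hka
            · omega
            · simp [hka] at hk)
          (fun k hk => Pi.single_eq_of_ne (by rintro rfl; exact haS hk) _) D
      obtain ⟨D', hD', hne'⟩ := key _ (step.isSymm hD) (step.row_eq_zero hS) ⟨a, ha, by
        simp only [Matrix.of_apply, Pi.single_eq_same, haa, hbb, hD.apply a b]
        intro h
        exact hab ((mul_eq_zero.1 (show 2 * D a b = 0 by linear_combination h)).resolve_left h2)⟩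
      exact ⟨D', step.trans hD', hne'⟩
    · exact key D hD hS ⟨b, hb, hbb⟩
  · exact key D hD hS ⟨a, ha, haa⟩

theorem exists_congr_row_diag (hsq : ∀ a : F, ∃ b : F, b ^ 2 = a) (hD : D.IsSymm)
    (hS : ∀ a ∈ S, ∀ b, D a b = 0) {i : ι} (hi : i ∉ S) (hge : LevelsGE ℓ (ℓ i) (ℓ i) D)
    (hii : D i i ≠ 0) :
    ∃ D', FlagCongr ℓ S D D' ∧ ∀ b, D' i b = if b = i then 1 else 0 := by
  obtain ⟨s, hs⟩ := hsq (D i i)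
  have hs0 : s ≠ 0 := by rintro rfl; exact hii (by simpa using hs.symm)
  refine ⟨_, FlagCongr.elementary (p := i)
    (c := fun b => if b = i then 1 / s - 1 else - D i b / D i i) hi (by simp [hs0]) ?_ ?_ D, ?_⟩
  · intro b hb
    rcases eq_or_ne b i with rfl | hbi
    · exact le_rfl
    · have : D i b ≠ 0 := by intro h; simp [hbi, h] at hb
      have := hge i b this
      omega
  · intro b hb
    have hbi : b ≠ i := by rintro rfl; exact hi hb
    have : D i b = 0 := by rw [← hD.apply, hS b hb]
    simp [hbi, this]
  · intro b
    rcases eq_or_ne b i with rfl | hbi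
    · simp only [Matrix.of_apply, if_true, ← hs]
      field_simp
      ring
    · simp only [Matrix.of_apply, if_true, hbi, if_false]
      field_simp
      ring

/-- A nonzero entry in an off-diagonal block can be moved to any position in that block. -/
theorem exists_congr_offDiag_ne_zero (hD : D.IsSymm)
    (hS : ∀ a ∈ S, ∀ b, D a b = 0) {i j : ι} (hi : i ∉ S) (hj : j ∉ S) (hij : ℓ i < ℓ j)
    (hne : ∃ a b, ℓ a = ℓ i ∧ ℓ b = ℓ j ∧ D a b ≠ 0) :
    ∃ D', FlagCongr ℓ S D D' ∧ D' i j ≠ 0 := by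
  have key (D : Matrix ι ι F) (hD : D.IsSymm) (hS : ∀ a ∈ S, ∀ b, D a b = 0) {i j : ι}
      (hi : i ∉ S) (hij : ℓ i ≠ ℓ j) {a : ι} (ha : ℓ a = ℓ i) (haj : D a j ≠ 0) :
      ∃ D', FlagCongr ℓ S D D' ∧ D' i j ≠ 0 := by
    by_cases h0 : D i j = 0
    · have hai : a ≠ i := by rintro rfl; exact haj h0
      have hji : j ≠ i := by rintro rfl; exact hij rfl
      refine ⟨_, FlagCongr.elementary (p := a) (c := Pi.single i 1) (notMem_of_ne_zero hS haj)
          (by simp [hai])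
          (fun b hb => by
            rcases eq_or_ne b i with rfl | hbi
            · exact ha.le
            · simp [hbi] at hb)
          (fun b hb => Pi.single_eq_of_ne (by rintro rfl; exact hi hb) _) D, ?_⟩
      simpa [h0, hji] using haj
    · exact ⟨D, .refl, h0⟩
  obtain ⟨a, b, ha, hb, hab⟩ := hne
  obtain ⟨D₁, h₁, hne₁⟩ := key D hD hS hi (j := b) (by omega) ha hab
  have hD₁ := h₁.isSymm hD
  obtain ⟨D₂, h₂, hne₂⟩ := key D₁ hD₁ (h₁.row_eq_zero hS) hj (j := i) (by omega) hb
    (by rwa [hD₁.apply])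
  exact ⟨D₂, h₁.trans h₂, by rwa [(h₂.isSymm hD₁).apply] at hne₂⟩

theorem exists_congr_row_offDiag (h2 : (2 : F) ≠ 0) (hD : D.IsSymm)
    (hS : ∀ a ∈ S, ∀ b, D a b = 0) {i j : ι} (hi : i ∉ S) (hj : j ∉ S) (hij : ℓ i < ℓ j)
    (hge : LevelsGE ℓ (ℓ i) (ℓ j) D) (hne : D i j ≠ 0) :
    ∃ D', FlagCongr ℓ S D D' ∧ (∀ b, D' i b = if b = j then 1 else 0) ∧
      ∀ b, D' j b = if b = i then 1 else 0 := by
  have hrow (D : Matrix ι ι F) (hge : LevelsGE ℓ (ℓ i) (ℓ j) D) {b : ι} (hb : D i b ≠ 0) :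
      ℓ j ≤ ℓ b := by
    have := hge i b hb
    omega
  have hinej : i ≠ j := by rintro rfl; exact lt_irrefl _ hij
  have hii : D i i = 0 := by
    by_contra h
    exact absurd (hrow D hge h) (not_le.2 hij)
  obtain ⟨D₁, h₁, hD₁i⟩ : ∃ D₁, FlagCongr ℓ S D D₁ ∧ ∀ b, D₁ i b = if b = j then 1 else 0 := by
    refine ⟨_, FlagCongr.elementary (p := j)
      (c := fun b => if b = j then 1 / D i j - 1 else - D i b / D i j) hj (by simp [hne]) ?_ ?_ D,
      ?_⟩
    · intro b hb
      rcases eq_or_ne b j with rfl | hbj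
      · exact le_rfl
      · exact hrow D hge (by intro h; simp [hbj, h] at hb)
    · intro b hb
      have hbj : b ≠ j := by rintro rfl; exact hj hb
      have : D i b = 0 := by rw [← hD.apply, hS b hb]
      simp [hbj, this]
    · intro b
      rcases eq_or_ne b j with rfl | hbj
      · simp [hinej, hii, hne, sub_mul]
      · simp [hinej, hii, hne, hbj]
  have hD₁ := h₁.isSymm hD
  have hS₁ := h₁.row_eq_zero hS
  have hge₁ := hge.congr h₁
  have hji : D₁ j i = 1 := by rw [hD₁.apply, hD₁i]; simp
  have hcol (a : ι) : D₁ a i = if a = j then 1 else 0 := by rw [hD₁.apply, hD₁i]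
  refine ⟨_, h₁.trans (FlagCongr.elementary (p := i)
    (c := fun b => if b = i then 0 else if b = j then - D₁ j j / 2 else - D₁ j b) hi (by simp)
    ?_ ?_ D₁), ?_, ?_⟩
  · intro b hb
    rcases eq_or_ne b i with rfl | hbi
    · exact le_rfl
    · rcases eq_or_ne b j with rfl | hbj
      · exact hij.le
      · have : D₁ b j ≠ 0 := by
          rw [hD₁.apply]; intro h; simp [hbi, hbj, h] at hb
        have := hge₁ b j this
        omega
  · intro b hb
    have hbi : b ≠ i := by rintro rfl; exact hi hb
    have hbj : b ≠ j := by rintro rfl; exact hj hb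
    have : D₁ j b = 0 := by rw [← hD₁.apply, hS₁ b hb]
    simp [hbi, hbj, this]
  · intro b
    simp [hD₁i, hinej]
  · intro b
    rcases eq_or_ne b i with rfl | hbi
    · simp [hD₁i, hji, hinej]
    · rcases eq_or_ne b j with rfl | hbj
      · simp only [Matrix.of_apply, hD₁i, hcol, hinej, hinej.symm, if_true, if_false]
        field_simp
        ring
      · simp [hD₁i, hji, hinej, hbi, hbj]

/-- A standard summand of the leading levels can be split off simultaneously from all symmetric
matrices sharing these leading levels. -/
theorem exists_split (h2 : (2 : F) ≠ 0) (hsq : ∀ a : F, ∃ b : F, b ^ 2 = a) {i j : ι}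
    (hi : i ∉ S) (hj : j ∉ S) (hij : ℓ i ≤ ℓ j) :
    ∃ (T : Finset ι) (E : Matrix ι ι F), S ⊂ T ∧ E.IsSymm ∧ (∀ a b, a ∉ T → E a b = 0) ∧
      ∀ D : Matrix ι ι F, D.IsSymm → (∀ a ∈ S, ∀ b, D a b = 0) → LevelsGE ℓ (ℓ i) (ℓ j) D →
        (∃ a b, ℓ a = ℓ i ∧ ℓ b = ℓ j ∧ D a b ≠ 0) →
        ∃ D' : Matrix ι ι F, FlagCongr ℓ S D (E + D') ∧ ∀ a ∈ T, ∀ b, D' a b = 0 := by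
  rcases hij.eq_or_lt with heq | hlt
  · refine ⟨insert i S, Matrix.single i i 1, Finset.ssubset_insert hi, ?_, ?_, ?_⟩
    · simp [Matrix.IsSymm]
    · intro a b ha
      have : i ≠ a := by rintro rfl; simp at ha
      simp [this]
    · intro D hD hS hge hne
      rw [← heq] at hge hne
      obtain ⟨D₁, h₁, hne₁⟩ := exists_congr_diag_ne_zero h2 hD hS hi hne
      obtain ⟨D₂, h₂, hrow⟩ := exists_congr_row_diag hsq (h₁.isSymm hD) (h₁.row_eq_zero hS) hi
        (hge.congr h₁) hne₁
      have h₁₂ := h₁.trans h₂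
      refine ⟨D₂ - Matrix.single i i 1, by simpa using h₁₂, fun a ha b => ?_⟩
      rcases Finset.mem_insert.1 ha with rfl | ha
      · simp [hrow, Matrix.single_apply, eq_comm]
      · have : i ≠ a := by rintro rfl; exact hi ha
        simp [h₁₂.row_eq_zero hS a ha b, this]
  · have hinej : i ≠ j := by rintro rfl; exact lt_irrefl _ hlt
    refine ⟨insert i (insert j S), Matrix.single i j 1 + Matrix.single j i 1, ?_, ?_, ?_, ?_⟩
    · exact (Finset.ssubset_insert hj).trans_subset (Finset.subset_insert _ _)
    · simp [Matrix.IsSymm, add_comm]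
    · intro a b ha
      simp only [Finset.mem_insert, not_or] at ha
      simp [Ne.symm ha.1, Ne.symm ha.2.1]
    · intro D hD hS hge hne
      obtain ⟨D₁, h₁, hne₁⟩ := exists_congr_offDiag_ne_zero hD hS hi hj hlt hne
      obtain ⟨D₂, h₂, hrow, hrow'⟩ := exists_congr_row_offDiag h2 (h₁.isSymm hD)
        (h₁.row_eq_zero hS) hi hj hlt (hge.congr h₁) hne₁
      have h₁₂ := h₁.trans h₂
      refine ⟨D₂ - (Matrix.single i j 1 + Matrix.single j i 1), by simpa using h₁₂,
        fun a ha b => ?_⟩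
      simp only [Finset.mem_insert] at ha
      rcases ha with rfl | rfl | ha
      · simp [hrow, Matrix.single_apply, eq_comm, hinej.symm]
      · simp [hrow', Matrix.single_apply, eq_comm, hinej]
      · have hia : i ≠ a := by rintro rfl; exact hi ha
        have hja : j ≠ a := by rintro rfl; exact hj ha
        simp [h₁₂.row_eq_zero hS a ha b, hia, hja]

/-- The ranks of the restrictions to pairs of members of a flag classify symmetric bilinear forms
up to flag automorphisms. -/
theorem flagCongr_of_levelRank_eq (h2 : (2 : F) ≠ 0) (hsq : ∀ a : F, ∃ b : F, b ^ 2 = a)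
    (S : Finset ι) : ∀ C D : Matrix ι ι F, C.IsSymm → D.IsSymm →
      (∀ a ∈ S, ∀ b, C a b = 0) → (∀ a ∈ S, ∀ b, D a b = 0) →
      (∀ x y, levelRank ℓ C x y = levelRank ℓ D x y) → FlagCongr ℓ S C D := by
  induction S using WellFoundedGT.induction with
  | ind S ih =>
    intro C D hC hD hCS hDS hr
    by_cases hC0 : C = 0
    · have hD0 : D = 0 := by
        ext a b
        by_contra hab
        have : levelRank ℓ D (ℓ a) (ℓ b) ≠ 0 :=
          (levelRank_ne_zero_iff _ _).2 ⟨a, b, le_rfl, le_rfl, hab⟩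
        rw [← hr, levelRank_ne_zero_iff] at this
        obtain ⟨k, l, -, -, hkl⟩ := this
        simp [hC0] at hkl
      rw [hC0, hD0]
      exact .refl
    obtain ⟨i, j, hij, hge⟩ := exists_levelsGE (ℓ := ℓ) hC0
    have hij' : C j i ≠ 0 := by rwa [hC.apply]
    have hle : ℓ i ≤ ℓ j := by
      have := hge j i hij'
      omega
    have hgeD := hge.of_levelRank_eq hr
    have hneD : levelRank ℓ D (ℓ i) (ℓ j) ≠ 0 := by
      rw [← hr, levelRank_ne_zero_iff]
      exact ⟨i, j, le_rfl, le_rfl, hij⟩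
    obtain ⟨T, E, hST, hE, hEr, hsplit⟩ := exists_split (ℓ := ℓ) h2 hsq
      (notMem_of_ne_zero hCS hij) (notMem_of_ne_zero hCS hij') hle
    obtain ⟨C', hCC', hC'⟩ := hsplit C hC hCS hge ⟨i, j, rfl, rfl, hij⟩
    obtain ⟨D', hDD', hD'⟩ := hsplit D hD hDS hgeD (hgeD.exists_ne_zero hneD)
    have hEc (a b : ι) (hb : b ∉ T) : E a b = 0 := by rw [← hE.apply, hEr _ _ hb]
    have hC's : C'.IsSymm := by simpa using (hCC'.isSymm hC).sub hE
    have hD's : D'.IsSymm := by simpa using (hDD'.isSymm hD).sub hE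
    have hcongr : FlagCongr ℓ T C' D' := by
      refine ih T hST C' D' hC's hD's hC' hD' fun x y => ?_
      have h₁ := hCC'.levelRank_eq x y
      have h₂ := hDD'.levelRank_eq x y
      rw [levelRank_add_of_support (S := T) hEr hEc (fun a b ha => hC' a ha b)
        (fun a b hb => by rw [← hC's.apply, hC' b hb])] at h₁
      rw [levelRank_add_of_support (S := T) hEr hEc (fun a b ha => hD' a ha b)
        (fun a b hb => by rw [← hD's.apply, hD' b hb])] at h₂
      have := hr x y
      omega
    exact (hCC'.trans (hcongr.add_of_support hST.subset hEr hEc)).trans hDD'.symm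

end FlagCongruence

/-- The number of members of the flag, up to index `r`, not containing a basis vector. -/
def parabolicLevel (M : ℕ → ℕ) (r : ℕ) (a : Fin n) : ℕ :=
  ((Finset.range (r + 1)).filter fun j => M j ≤ (a : ℕ)).card

theorem inP_iff_isFlagAut {M : ℕ → ℕ} {r : ℕ} {g : Matrix (Fin n) (Fin n) F} :
    InP M r g ↔ IsFlagAut (parabolicLevel M r) ∅ g := by
  constructor
  · rintro ⟨hdet, hg⟩
    refine ⟨hdet, fun a b hab => ?_, by simp, by simp⟩
    obtain ⟨j, hja, hjb⟩ := Finset.exists_mem_notMem_of_card_lt_card hab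
    simp only [Finset.mem_filter, Finset.mem_range, not_and, not_le] at hja hjb
    exact hg j (by omega) a b (hjb hja.1) hja.2
  · intro hg
    refine ⟨hg.isUnit_det, fun j hj a b hb ha => hg.blockTriangular (Finset.card_lt_card ?_)⟩
    rw [Finset.ssubset_iff_of_subset]
    · exact ⟨j, by simp; omega, by simp; omega⟩
    · intro k hk
      simp only [Finset.mem_filter] at hk ⊢
      exact ⟨hk.1, hk.2.trans (hb.le.trans ha)⟩

/-- If `char F ≠ 2` and every element of `F` is a square, two symmetric matrices
are `P`-congruent iff they are `P`-equivalent. -/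
theorem symm_P_congruent_iff_P_equivalent (hn : 2 ≤ n) (hchar : (2 : F) ≠ 0)
    (hsq : ∀ a : F, ∃ b : F, b ^ 2 = a) (r : ℕ) (M : ℕ → ℕ)
    (hM0 : M 0 = 0) (hMr : M r = n) (hMmono : ∀ i < r, M i < M (i + 1))
    (C D : Matrix (Fin n) (Fin n) F) (hC : C.IsSymm) (hD : D.IsSymm) :
    (∃ h : Matrix (Fin n) (Fin n) F, InP M r h ∧ D = hᵀ * C * h) ↔
      (∃ h k : Matrix (Fin n) (Fin n) F, InP M r h ∧ InP M r k ∧ D = hᵀ * C * k) := by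
  constructor
  · rintro ⟨h, hh, rfl⟩
    exact ⟨h, h, hh, hh, rfl⟩
  · rintro ⟨h, k, hh, hk, hDC⟩
    rw [inP_iff_isFlagAut] at hh hk
    obtain ⟨g, hg, hgD⟩ := flagCongr_of_levelRank_eq (ℓ := parabolicLevel M r) hchar hsq ∅ C D
      hC hD (by simp) (by simp) fun x y => by rw [hDC, levelRank_mul_mul hh hk]
    exact ⟨g, inP_iff_isFlagAut.2 hg, hgD⟩
end

section
/- Let P be the standard parabolic subgroup of GL_n(F) determined by the indices 0 = M_0 < M_1 < ... < M_r = n. Then two alternating n×n matrices C and D over F are P-congruent if and only if they are P-equivalent. -/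
open Matrix

variable {F : Type*} [Field F] {n : ℕ}

/-- An alternating matrix: `Xᵀ = -X` and all diagonal entries are 0. -/
def IsAlternating (X : Matrix (Fin n) (Fin n) F) : Prop :=
  Xᵀ = -X ∧ ∀ i, X i i = 0

namespace Matrix

variable {ι : Type*} [Fintype ι] [DecidableEq ι]

/-- The diagonal projection onto the coordinates of level at most `i`. -/
def levelProj (F : Type*) [Field F] (lev : ι → ℕ) (i : ℕ) : Matrix ι ι F :=
  diagonal fun a => if lev a ≤ i then 1 else 0

lemma levelProj_mul_mul_apply (lev : ι → ℕ) (i j : ℕ) (X : Matrix ι ι F) (a b : ι) :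
    (levelProj F lev i * X * levelProj F lev j) a b =
      if lev a ≤ i ∧ lev b ≤ j then X a b else 0 := by
  simp only [levelProj, diagonal_mul, mul_diagonal]
  split_ifs <;> simp_all

lemma BlockTriangular.mul_levelProj_s17 {lev : ι → ℕ} {k : Matrix ι ι F}
    (hk : k.BlockTriangular lev) (j : ℕ) :
    k * levelProj F lev j = levelProj F lev j * (k * levelProj F lev j) := by
  ext a b
  simp only [levelProj, diagonal_mul, mul_diagonal]
  by_cases hb : lev b ≤ j
  · by_cases ha : lev a ≤ j
    · simp [ha]
    · simp [ha, hk (show lev b < lev a by omega)]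
  · simp [hb]

/-- The rank of the corner of `X` formed by the rows of level at most `i` and the columns of
level at most `j`. -/
noncomputable def cornerRank (lev : ι → ℕ) (X : Matrix ι ι F) (i j : ℕ) : ℕ :=
  (levelProj F lev i * X * levelProj F lev j).rank

lemma cornerRank_equiv_le {lev : ι → ℕ} {h k : Matrix ι ι F} (hh : h.BlockTriangular lev)
    (hk : k.BlockTriangular lev) (X : Matrix ι ι F) (i j : ℕ) :
    cornerRank lev (hᵀ * X * k) i j ≤ cornerRank lev X i j := by
  have key : levelProj F lev i * (hᵀ * X * k) * levelProj F lev j =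
      (h * levelProj F lev i)ᵀ * (levelProj F lev i * X * levelProj F lev j) *
        (k * levelProj F lev j) := by
    have h1 : levelProj F lev i * hᵀ = (h * levelProj F lev i)ᵀ * levelProj F lev i := by
      have := congrArg transpose (hh.mul_levelProj_s17 i)
      simpa [levelProj, Matrix.mul_assoc] using this
    calc _ = (levelProj F lev i * hᵀ) * X * (k * levelProj F lev j) := by
          simp only [Matrix.mul_assoc]
      _ = _ := by
          rw [h1]
          simp only [Matrix.mul_assoc]
          rw [← hk.mul_levelProj_s17 j]
  unfold cornerRank
  rw [key]
  exact (rank_mul_le_left _ _).trans (rank_mul_le_right _ _)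

lemma cornerRank_equiv {lev : ι → ℕ} {h k : Matrix ι ι F} (hh : h.BlockTriangular lev)
    (hk : k.BlockTriangular lev) (uh : IsUnit h) (uk : IsUnit k) (X : Matrix ι ι F) (i j : ℕ) :
    cornerRank lev (hᵀ * X * k) i j = cornerRank lev X i j := by
  refine (cornerRank_equiv_le hh hk X i j).antisymm ?_
  have := uh.invertible
  have := uk.invertible
  have e : X = (h⁻¹)ᵀ * (hᵀ * X * k) * k⁻¹ := by
    have : (h⁻¹)ᵀ * hᵀ = 1 := by rw [← transpose_mul]; simp
    rw [← Matrix.mul_assoc, ← Matrix.mul_assoc, this]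
    simp
  conv_lhs => rw [e]
  exact cornerRank_equiv_le (blockTriangular_inv_of_blockTriangular hh)
    (blockTriangular_inv_of_blockTriangular hk) _ i j

lemma cornerRank_ne_zero_iff (lev : ι → ℕ) (X : Matrix ι ι F) (i j : ℕ) :
    cornerRank lev X i j ≠ 0 ↔ ∃ a b, X a b ≠ 0 ∧ lev a ≤ i ∧ lev b ≤ j := by
  have h0 (Y : Matrix ι ι F) : Y.rank = 0 ↔ Y = 0 := by
    rw [Matrix.rank, Submodule.finrank_eq_zero, LinearMap.range_eq_bot]
    constructor
    · intro h
      ext a b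
      simpa using congrFun (LinearMap.congr_fun h (Pi.single b 1)) a
    · rintro rfl
      ext
      simp
  rw [cornerRank, Ne, h0, ← Matrix.ext_iff]
  simp only [levelProj_mul_mul_apply, zero_apply]
  push Not
  refine exists_congr fun a => exists_congr fun b => ?_
  split_ifs <;> simp_all

lemma rank_add_of_disjoint_support {A B : Matrix ι ι F} (s : ι → Prop) [DecidablePred s]
    (hA : ∀ a b, A a b ≠ 0 → s a ∧ s b) (hB : ∀ a b, B a b ≠ 0 → ¬ s a ∧ ¬ s b) :
    (A + B).rank = A.rank + B.rank := by
  set p : Matrix ι ι F := diagonal fun a => if s a then 1 else 0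
  have hAp : A * p = A := by
    ext a b
    have := hA a b
    simp only [p, mul_diagonal]
    split_ifs <;> simp_all
  have hBp : B * p = 0 := by
    ext a b
    have := hB a b
    simp only [p, mul_diagonal]
    split_ifs <;> simp_all
  have hpA : p * A = A := by
    ext a b
    have := hA a b
    simp only [p, diagonal_mul]
    split_ifs <;> simp_all
  have hpB : p * B = 0 := by
    ext a b
    have := hB a b
    simp only [p, diagonal_mul]
    split_ifs <;> simp_all
  have hsup : LinearMap.range (A + B).mulVecLin =
      LinearMap.range A.mulVecLin ⊔ LinearMap.range B.mulVecLin := by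
    apply le_antisymm
    · rintro _ ⟨v, rfl⟩
      rw [mulVecLin_add]
      exact Submodule.add_mem_sup ⟨v, rfl⟩ ⟨v, rfl⟩
    · refine sup_le ?_ ?_
      · rintro _ ⟨v, rfl⟩
        refine ⟨p *ᵥ v, ?_⟩
        simp only [mulVecLin_apply, mulVec_mulVec, Matrix.add_mul, hAp, hBp, add_zero]
      · rintro _ ⟨v, rfl⟩
        refine ⟨(1 - p) *ᵥ v, ?_⟩
        simp only [mulVecLin_apply, mulVec_mulVec, Matrix.mul_sub, Matrix.add_mul, hAp, hBp,
          Matrix.mul_one, add_zero, add_sub_cancel_left]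
  have hinf : LinearMap.range A.mulVecLin ⊓ LinearMap.range B.mulVecLin = ⊥ := by
    rw [eq_bot_iff]
    rintro x ⟨⟨v, hv⟩, ⟨w, hw⟩⟩
    have h1 : p *ᵥ x = x := by
      rw [← hv, mulVecLin_apply, mulVec_mulVec, hpA]
    have h2 : p *ᵥ x = 0 := by
      rw [← hw, mulVecLin_apply, mulVec_mulVec, hpB, zero_mulVec]
    simpa [h1] using h2
  have := Submodule.finrank_sup_add_finrank_inf_eq (LinearMap.range A.mulVecLin)
    (LinearMap.range B.mulVecLin)
  rw [hinf, finrank_bot, add_zero, ← hsup] at this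
  exact this

lemma cornerRank_add_of_disjoint_support (lev : ι → ℕ) {A B : Matrix ι ι F} (s : ι → Prop)
    [DecidablePred s] (hA : ∀ a b, A a b ≠ 0 → s a ∧ s b)
    (hB : ∀ a b, B a b ≠ 0 → ¬ s a ∧ ¬ s b) (i j : ℕ) :
    cornerRank lev (A + B) i j = cornerRank lev A i j + cornerRank lev B i j := by
  unfold cornerRank
  rw [Matrix.mul_add, Matrix.add_mul]
  refine rank_add_of_disjoint_support s (fun a b h => hA a b ?_) (fun a b h => hB a b ?_) <;>
  · rw [levelProj_mul_mul_apply] at h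
    exact fun h' => h (by simp [h'])

/-- Alternating matrices supported on `S × S`. -/
structure IsAltOn (S : Finset ι) (X : Matrix ι ι F) : Prop where
  transpose_eq : Xᵀ = -X
  diag_eq : ∀ a, X a a = 0
  support : ∀ a b, X a b ≠ 0 → a ∈ S ∧ b ∈ S

omit [Fintype ι] [DecidableEq ι] in
lemma IsAltOn.apply_swap {S : Finset ι} {X : Matrix ι ι F} (hX : IsAltOn S X) (a b : ι) :
    X b a = -X a b :=
  congrFun (congrFun hX.transpose_eq a) b

/-- Invertible matrices that are block triangular for `lev` and agree with the identity outside
`S × S`. -/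
structure IsParabolicOn (lev : ι → ℕ) (S : Finset ι) (h : Matrix ι ι F) : Prop where
  isUnit : IsUnit h
  blockTriangular : h.BlockTriangular lev
  eq_one : ∀ a b, a ∉ S ∨ b ∉ S → h a b = (1 : Matrix ι ι F) a b

lemma IsParabolicOn.one (lev : ι → ℕ) (S : Finset ι) :
    IsParabolicOn lev S (1 : Matrix ι ι F) :=
  ⟨isUnit_one, blockTriangular_one, fun _ _ _ => rfl⟩

lemma IsParabolicOn.mul {lev : ι → ℕ} {S : Finset ι} {h k : Matrix ι ι F}
    (hh : IsParabolicOn lev S h) (hk : IsParabolicOn lev S k) : IsParabolicOn lev S (h * k) := by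
  refine ⟨hh.isUnit.mul hk.isUnit, hh.blockTriangular.mul hk.blockTriangular, ?_⟩
  rintro a b (ha | hb)
  · have : h a = (1 : Matrix ι ι F) a := funext fun c => hh.eq_one a c (.inl ha)
    rw [mul_apply, this, ← mul_apply, Matrix.one_mul, hk.eq_one a b (.inl ha)]
  · rw [mul_apply, Finset.sum_congr rfl fun c _ => by rw [hk.eq_one c b (.inr hb)], ← mul_apply,
      Matrix.mul_one, hh.eq_one a b (.inr hb)]

lemma IsParabolicOn.mono {lev : ι → ℕ} {S T : Finset ι} {h : Matrix ι ι F}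
    (hh : IsParabolicOn lev S h) (hST : S ⊆ T) : IsParabolicOn lev T h :=
  ⟨hh.isUnit, hh.blockTriangular, fun a b hab =>
    hh.eq_one a b (hab.imp (fun h hs => h (hST hs)) (fun h hs => h (hST hs)))⟩

/-- The hyperbolic plane on the coordinates `p` and `q`. -/
def hyperbolicPair (F : Type*) [Field F] (p q : ι) : Matrix ι ι F :=
  single p q 1 - single q p 1

omit [Fintype ι] in
lemma hyperbolicPair_support {p q a b : ι} (h : hyperbolicPair F p q a b ≠ 0) :
    (a = p ∨ a = q) ∧ (b = p ∨ b = q) := by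
  simp only [hyperbolicPair, sub_apply, single_apply] at h
  grind

lemma IsParabolicOn.hyperbolicPair_congr {lev : ι → ℕ} {S : Finset ι} {k : Matrix ι ι F}
    (hk : IsParabolicOn lev S k) {p q : ι} (hp : p ∉ S) (hq : q ∉ S) :
    kᵀ * hyperbolicPair F p q * k = hyperbolicPair F p q := by
  have aux (x y : ι) (hx : x ∉ S) (hy : y ∉ S) :
      kᵀ * single x y (1 : F) * k = single x y 1 := by
    ext a b
    rw [mul_apply, Finset.sum_eq_single y]
    · simp only [mul_single_apply_same, transpose_apply, mul_one, hk.eq_one x a (.inl hx),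
        hk.eq_one y b (.inl hy), one_apply, single_apply]
      split_ifs <;> simp_all
    · intro c _ hc
      rw [mul_single_apply_of_ne (hbj := hc), zero_mul]
    · simp
  rw [hyperbolicPair, Matrix.mul_sub, Matrix.sub_mul, aux p q hp hq, aux q p hq hp]

/-- The identity with `u` added to row `p` and `w` added to row `q`. -/
def addTwoRows (p q : ι) (u w : ι → F) : Matrix ι ι F :=
  of fun a b => (1 : Matrix ι ι F) a b + (if a = p then u b else 0) + (if a = q then w b else 0)

lemma mul_addTwoRows_apply (X : Matrix ι ι F) (p q : ι) (u w : ι → F) (a b : ι) :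
    (X * addTwoRows p q u w) a b = X a b + X a p * u b + X a q * w b := by
  simp [mul_apply, addTwoRows, mul_add, Finset.sum_add_distrib, one_apply]

lemma transpose_addTwoRows_mul_apply (X : Matrix ι ι F) (p q : ι) (u w : ι → F) (a b : ι) :
    ((addTwoRows p q u w)ᵀ * X) a b = X a b + u a * X p b + w a * X q b := by
  simp [mul_apply, addTwoRows, add_mul, Finset.sum_add_distrib, one_apply]

lemma IsAltOn.exists_split {lev : ι → ℕ} {S : Finset ι} {C : Matrix ι ι F} (hC : IsAltOn S C)
    {p q : ι} (hpq : C p q ≠ 0) (hp : ∀ a b, C a b ≠ 0 → lev p ≤ lev a)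
    (hq : ∀ a, C p a ≠ 0 → lev q ≤ lev a) :
    ∃ h C₁, IsParabolicOn lev S h ∧ IsAltOn (S \ {p, q}) C₁ ∧
      hᵀ * C * h = hyperbolicPair F p q + C₁ := by
  have hne : p ≠ q := fun h => hpq (h ▸ hC.diag_eq p)
  obtain ⟨hpS, hqS⟩ := hC.support p q hpq
  set c := C p q with hc
  have hqp : C q p = -c := hC.apply_swap p q
  have hpp := hC.diag_eq p
  have hqq := hC.diag_eq q
  set u : ι → F := fun b => if b = p ∨ b = q then 0 else C q b / c with hu
  set w : ι → F := fun b => if b = p then 0 else if b = q then c⁻¹ - 1 else -C p b / c with hw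
  set h := addTwoRows p q u w with hh
  have entry (a b : ι) : (hᵀ * C * h) a b =
      (C a b + u a * C p b + w a * C q b) + (C a p + u a * C p p + w a * C q p) * u b +
        (C a q + u a * C p q + w a * C q q) * w b := by
    rw [hh, mul_addTwoRows_apply]
    simp only [transpose_addTwoRows_mul_apply]
  refine ⟨h, hᵀ * C * h - hyperbolicPair F p q, ⟨?_, ?_, ?_⟩, ⟨?_, ?_, ?_⟩, by abel⟩
  · refine IsUnit.of_mul_eq_one (addTwoRows p q (-u) (-c • w)) ?_
    ext a b
    rw [mul_addTwoRows_apply]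
    simp only [hh, addTwoRows, of_apply, hu, hw, Pi.neg_apply, Pi.smul_apply, smul_eq_mul,
      one_apply]
    have hc0 : c * c⁻¹ = 1 := mul_inv_cancel₀ hpq
    grind
  · intro a b hab
    have h1 := hp b q
    have h2 := hq b
    have h3 := hC.apply_swap q b
    simp only [hh, addTwoRows, of_apply, hu, hw, one_apply]
    grind
  · intro a b hab
    have h1 := hC.support p b
    have h2 := hC.support q b
    simp only [hh, addTwoRows, of_apply, hu, hw]
    grind
  · have hH : (hyperbolicPair F p q)ᵀ = -hyperbolicPair F p q := by
      simp [hyperbolicPair]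
    rw [transpose_sub, hH, transpose_mul, transpose_mul, transpose_transpose, hC.transpose_eq]
    simp only [Matrix.neg_mul, Matrix.mul_neg, Matrix.mul_assoc]
    abel
  · intro a
    rw [sub_apply, entry, hpp, hqq, hC.diag_eq, hC.apply_swap p a, hC.apply_swap q a, hqp, ← hc]
    simp only [hyperbolicPair, sub_apply, single_apply]
    rw [if_neg (by grind), if_neg (by grind)]
    ring
  · intro a b hab
    by_contra hS
    apply hab
    have h1 : ∀ x, C x p = -C p x := fun x => hC.apply_swap p x
    have h2 : ∀ x, C x q = -C q x := fun x => hC.apply_swap q x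
    have h3 := hC.support a b
    have h4 := hC.support p b
    have h5 := hC.support q b
    have h6 := hC.support p a
    have h7 := hC.support q a
    rw [sub_apply, entry, hpp, hqq, h1 a, h2 a, hqp, ← hc]
    simp only [hyperbolicPair, sub_apply, single_apply, hu, hw]
    simp only [Finset.mem_sdiff, Finset.mem_insert, Finset.mem_singleton] at hS
    have hc0 : c * c⁻¹ = 1 := mul_inv_cancel₀ hpq
    grind

omit [Fintype ι] in
lemma exists_perm_congr {lev : ι → ℕ} {S : Finset ι} {p q p' q' : ι} (hpq : p ≠ q)
    (hpq' : p' ≠ q') (hp : p ∈ S) (hq : q ∈ S) (hp' : p' ∈ S) (hq' : q' ∈ S)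
    (hlp : lev p' = lev p) (hlq : lev q' = lev q) :
    ∃ σ : Equiv.Perm ι, σ p = p' ∧ σ q = q' ∧ (∀ a, lev (σ a) = lev a) ∧
      ∀ a ∉ S, σ a = a := by
  refine ⟨Equiv.swap p p' * Equiv.swap q (Equiv.swap p p' q'), ?_, ?_, ?_, ?_⟩
  · simp only [Equiv.Perm.mul_apply, Equiv.swap_apply_def]
    grind
  · simp
  · intro a
    simp only [Equiv.Perm.mul_apply, Equiv.swap_apply_def]
    grind
  · intro a ha
    simp only [Equiv.Perm.mul_apply, Equiv.swap_apply_def]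
    grind

lemma exists_isParabolicOn_submatrix {lev : ι → ℕ} {S : Finset ι} (σ : Equiv.Perm ι)
    (hlev : ∀ a, lev (σ a) = lev a) (hS : ∀ a ∉ S, σ a = a) (X : Matrix ι ι F) :
    ∃ h, IsParabolicOn lev S h ∧ hᵀ * X * h = X.submatrix σ σ := by
  set h : Matrix ι ι F := of fun a b => if a = σ b then 1 else 0 with hh
  refine ⟨h, ⟨?_, ?_, ?_⟩, ?_⟩
  · refine IsUnit.of_mul_eq_one_right hᵀ ?_
    ext a b
    simp [mul_apply, hh, one_apply, eq_comm]
  · intro a b hab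
    have := hlev b
    simp only [hh, of_apply]
    grind
  · intro a b hab
    have h1 : σ b = a → a ∉ S → a = b := fun h1 h2 => σ.injective (by rw [h1, hS a h2])
    simp only [hh, of_apply, one_apply]
    have := hS a
    have := hS b
    grind
  · ext a b
    simp [mul_apply, hh]

omit [Fintype ι] [DecidableEq ι] in
lemma IsAltOn.submatrix {S : Finset ι} {X : Matrix ι ι F} (hX : IsAltOn S X) (σ : Equiv.Perm ι)
    (hS : ∀ a ∉ S, σ a = a) : IsAltOn S (X.submatrix σ σ) := by
  refine ⟨?_, fun a => hX.diag_eq _, fun a b hab => ?_⟩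
  · rw [transpose_submatrix, hX.transpose_eq]
    rfl
  · have := hX.support _ _ hab
    have := hS a
    have := hS b
    grind

theorem exists_congr_eq_congr_of_cornerRank_eq (lev : ι → ℕ) (S : Finset ι) :
    ∀ C D : Matrix ι ι F, IsAltOn S C → IsAltOn S D →
      (∀ i j, cornerRank lev C i j = cornerRank lev D i j) →
      ∃ h k, IsParabolicOn lev S h ∧ IsParabolicOn lev S k ∧ hᵀ * C * h = kᵀ * D * k := by
  classical
  induction S using Finset.strongInduction with
  | H S ih =>
  intro C D hC hD hr
  have hiff (i j : ℕ) : (∃ a b, C a b ≠ 0 ∧ lev a ≤ i ∧ lev b ≤ j) ↔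
      ∃ a b, D a b ≠ 0 ∧ lev a ≤ i ∧ lev b ≤ j := by
    rw [← cornerRank_ne_zero_iff, ← cornerRank_ne_zero_iff, hr]
  by_cases hex : ∃ i j, ∃ a b, C a b ≠ 0 ∧ lev a ≤ i ∧ lev b ≤ j
  swap
  · have hex' : ¬ ∃ i j, ∃ a b, D a b ≠ 0 ∧ lev a ≤ i ∧ lev b ≤ j := by
      simpa only [hiff] using hex
    have zero {X : Matrix ι ι F} (hX : ¬ ∃ i j, ∃ a b, X a b ≠ 0 ∧ lev a ≤ i ∧ lev b ≤ j) :
        X = 0 := by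
      ext a b
      by_contra h
      exact hX ⟨lev a, lev b, a, b, h, le_rfl, le_rfl⟩
    exact ⟨1, 1, .one _ _, .one _ _, by rw [zero hex, zero hex']⟩
  obtain ⟨i, hi, himin⟩ : ∃ i, (∃ j, ∃ a b, C a b ≠ 0 ∧ lev a ≤ i ∧ lev b ≤ j) ∧
      ∀ i' < i, ¬ ∃ j, ∃ a b, C a b ≠ 0 ∧ lev a ≤ i' ∧ lev b ≤ j :=
    ⟨Nat.find hex, Nat.find_spec hex, fun _ => Nat.find_min hex⟩
  obtain ⟨j, hj, hjmin⟩ : ∃ j, (∃ a b, C a b ≠ 0 ∧ lev a ≤ i ∧ lev b ≤ j) ∧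
      ∀ j' < j, ¬ ∃ a b, C a b ≠ 0 ∧ lev a ≤ i ∧ lev b ≤ j' :=
    ⟨Nat.find hi, Nat.find_spec hi, fun _ => Nat.find_min hi⟩
  have row {X : Matrix ι ι F} (hX : ∀ i j, (∃ a b, C a b ≠ 0 ∧ lev a ≤ i ∧ lev b ≤ j) ↔
      ∃ a b, X a b ≠ 0 ∧ lev a ≤ i ∧ lev b ≤ j) (a b : ι) (hab : X a b ≠ 0) : i ≤ lev a := by
    by_contra! hlt
    exact himin _ hlt ⟨lev b, (hX _ _).2 ⟨a, b, hab, le_rfl, le_rfl⟩⟩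
  have col {X : Matrix ι ι F} (hX : ∀ i j, (∃ a b, C a b ≠ 0 ∧ lev a ≤ i ∧ lev b ≤ j) ↔
      ∃ a b, X a b ≠ 0 ∧ lev a ≤ i ∧ lev b ≤ j) (a b : ι) (ha : lev a ≤ i) (hab : X a b ≠ 0) :
      j ≤ lev b := by
    by_contra! hlt
    exact hjmin _ hlt ((hX _ _).2 ⟨a, b, hab, ha, le_rfl⟩)
  have hCC (i j : ℕ) : (∃ a b, C a b ≠ 0 ∧ lev a ≤ i ∧ lev b ≤ j) ↔
      ∃ a b, C a b ≠ 0 ∧ lev a ≤ i ∧ lev b ≤ j := Iff.rfl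
  obtain ⟨p', q', hpq', hp', hq'⟩ := (hiff i j).1 hj
  obtain ⟨p, q, hpq, hp, hq⟩ := hj
  have hlp : lev p = i := hp.antisymm (row hCC p q hpq)
  have hlq : lev q = j := hq.antisymm (col hCC p q hp hpq)
  have hlp' : lev p' = i := hp'.antisymm (row hiff p' q' hpq')
  have hlq' : lev q' = j := hq'.antisymm (col hiff p' q' hp' hpq')
  obtain ⟨hpS, hqS⟩ := hC.support p q hpq
  obtain ⟨hpS', hqS'⟩ := hD.support p' q' hpq'
  obtain ⟨σ, hσp, hσq, hσ, hσS⟩ := exists_perm_congr (lev := lev) (S := S)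
    (fun e => hpq (by rw [← e, hC.diag_eq])) (fun e => hpq' (by rw [← e, hD.diag_eq]))
    hpS hqS hpS' hqS' (hlp'.trans hlp.symm) (hlq'.trans hlq.symm)
  obtain ⟨g, hg, hgD⟩ := exists_isParabolicOn_submatrix σ hσ hσS D
  obtain ⟨h, C₁, hh, hC₁, hCeq⟩ := hC.exists_split hpq
    (fun a b hab => hlp ▸ row hCC a b hab) (fun a ha => hlq ▸ col hCC p a hp ha)
  obtain ⟨k, D₁, hk, hD₁, hDeq⟩ := (hD.submatrix σ hσS).exists_split (lev := lev) (p := p) (q := q)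
    (by simpa [hσp, hσq] using hpq')
    (fun a b hab => by
      rw [hlp, ← hσ a]
      exact row hiff _ _ hab)
    (fun a ha => by
      rw [hlq, ← hσ a]
      exact col hiff _ _ (by rw [hσ, hlp]) ha)
  have rank_split {X : Matrix ι ι F} (hX : IsAltOn (S \ {p, q}) X) (i j : ℕ) :
      cornerRank lev (hyperbolicPair F p q + X) i j =
        cornerRank lev (hyperbolicPair F p q) i j + cornerRank lev X i j := by
    refine cornerRank_add_of_disjoint_support lev (fun a => a = p ∨ a = q)
      (fun a b hab => hyperbolicPair_support hab) (fun a b hab => ?_) i j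
    have := hX.support a b hab
    simp only [Finset.mem_sdiff, Finset.mem_insert, Finset.mem_singleton] at this
    exact ⟨this.1.2, this.2.2⟩
  obtain ⟨h₁, k₁, hh₁, hk₁, heq⟩ := ih (S \ {p, q})
    (Finset.sdiff_ssubset (by grind) (by simp)) C₁ D₁ hC₁ hD₁ fun i j => by
      have e1 := rank_split hC₁ i j
      have e2 := rank_split hD₁ i j
      rw [← hCeq, cornerRank_equiv hh.blockTriangular hh.blockTriangular hh.isUnit hh.isUnit] at e1
      rw [← hDeq, ← hgD,
        cornerRank_equiv hk.blockTriangular hk.blockTriangular hk.isUnit hk.isUnit,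
        cornerRank_equiv hg.blockTriangular hg.blockTriangular hg.isUnit hg.isUnit, ← hr] at e2
      omega
  refine ⟨h * h₁, g * k * k₁, hh.mul (hh₁.mono Finset.sdiff_subset),
    (hg.mul hk).mul (hk₁.mono Finset.sdiff_subset), ?_⟩
  have hpn : p ∉ S \ {p, q} := by simp
  have hqn : q ∉ S \ {p, q} := by simp
  calc (h * h₁)ᵀ * C * (h * h₁) = h₁ᵀ * (hᵀ * C * h) * h₁ := by
        simp only [transpose_mul, Matrix.mul_assoc]
    _ = k₁ᵀ * (kᵀ * (gᵀ * D * g) * k) * k₁ := by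
        rw [hCeq, hgD, hDeq, Matrix.mul_add, Matrix.add_mul, Matrix.mul_add, Matrix.add_mul,
          hh₁.hyperbolicPair_congr hpn hqn, hk₁.hyperbolicPair_congr hpn hqn, heq]
    _ = _ := by simp only [transpose_mul, Matrix.mul_assoc]

end Matrix

/-- The number of the subspaces of the flag that do not contain the basis vector `a`. -/
def flagLevel (M : ℕ → ℕ) (r : ℕ) (a : Fin n) : ℕ :=
  ((Finset.range (r + 1)).filter fun j => M j ≤ (a : ℕ)).card

lemma flagLevel_lt_iff {M : ℕ → ℕ} {r : ℕ} {a b : Fin n} :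
    flagLevel M r b < flagLevel M r a ↔ ∃ j ≤ r, (b : ℕ) < M j ∧ M j ≤ (a : ℕ) := by
  constructor
  · intro h
    by_contra! hno
    refine h.not_ge (Finset.card_le_card fun j => ?_)
    simp only [Finset.mem_filter, Finset.mem_range]
    rintro ⟨hj, hja⟩
    refine ⟨hj, ?_⟩
    by_contra! hb
    exact (hno j (by omega) hb).not_ge hja
  · rintro ⟨j, hj, hb, ha⟩
    refine Finset.card_lt_card ((Finset.ssubset_iff_of_subset fun i => ?_).2 ⟨j, ?_, ?_⟩)
    · simp only [Finset.mem_filter]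
      exact fun h => ⟨h.1, h.2.trans (by omega)⟩
    · simp only [Finset.mem_filter, Finset.mem_range]
      omega
    · simp only [Finset.mem_filter, Finset.mem_range]
      omega

lemma inP_iff {M : ℕ → ℕ} {r : ℕ} {g : Matrix (Fin n) (Fin n) F} :
    InP M r g ↔ IsUnit g ∧ g.BlockTriangular (flagLevel M r) := by
  rw [InP, ← Matrix.isUnit_iff_isUnit_det]
  refine and_congr_right fun _ => ⟨fun h a b hab => ?_, fun h j hj a b hb ha => ?_⟩
  · obtain ⟨j, hj, hb, ha⟩ := flagLevel_lt_iff.1 hab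
    exact h j hj a b hb ha
  · exact h (flagLevel_lt_iff.2 ⟨j, hj, hb, ha⟩)

/-- Two alternating matrices are `P`-congruent iff they are `P`-equivalent. -/
theorem alt_P_congruent_iff_P_equivalent (hn : 2 ≤ n) (r : ℕ) (M : ℕ → ℕ)
    (hM0 : M 0 = 0) (hMr : M r = n) (hMmono : ∀ i < r, M i < M (i + 1))
    (C D : Matrix (Fin n) (Fin n) F) (hC : IsAlternating C) (hD : IsAlternating D) :
    (∃ h : Matrix (Fin n) (Fin n) F, InP M r h ∧ D = hᵀ * C * h) ↔
      (∃ h k : Matrix (Fin n) (Fin n) F, InP M r h ∧ InP M r k ∧ D = hᵀ * C * k) := by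
  refine ⟨fun ⟨h, hh, e⟩ => ⟨h, h, hh, hh, e⟩, ?_⟩
  rintro ⟨h, k, hh, hk, e⟩
  rw [inP_iff] at hh hk
  obtain ⟨f, g, hf, hg, hfg⟩ := Matrix.exists_congr_eq_congr_of_cornerRank_eq (flagLevel M r)
    Finset.univ C D ⟨hC.1, hC.2, by simp⟩ ⟨hD.1, hD.2, by simp⟩ fun i j => by
      rw [e, Matrix.cornerRank_equiv hh.2 hk.2 hh.1 hk.1]
  have := hg.isUnit.invertible
  refine ⟨f * g⁻¹, inP_iff.2 ⟨hf.isUnit.mul ?_, hf.blockTriangular.mul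
    (Matrix.blockTriangular_inv_of_blockTriangular hg.blockTriangular)⟩, ?_⟩
  · exact (Matrix.isUnit_nonsing_inv_iff).2 hg.isUnit
  · have hinv : (g⁻¹)ᵀ * gᵀ = 1 := by rw [← Matrix.transpose_mul]; simp
    calc D = ((g⁻¹)ᵀ * gᵀ) * D * (g * g⁻¹) := by rw [hinv]; simp
      _ = (g⁻¹)ᵀ * (gᵀ * D * g) * g⁻¹ := by simp only [Matrix.mul_assoc]
      _ = _ := by rw [← hfg]; simp only [Matrix.transpose_mul, Matrix.mul_assoc]
end
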